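/- Every graph in 𝒢₀ is θ⁺-free, i.e., has no induced subgraph isomorphic to θ⁺. -/

import Mathlib

open SimpleGraph

/-- A *hole* of length `n` in `G`: an induced cycle of length `n ≥ 4`. -/
def SimpleGraph.HasHole {V : Type*} (G : SimpleGraph V) (n : ℕ) : Prop :=
  4 ≤ n ∧ ∃ (v : V) (w : G.Walk v v), w.IsCycle ∧ w.toSubgraph.IsInduced ∧ w.length = n

/-- `G ∈ 𝒢_ℓ`: `G` has girth `2ℓ+1` and no odd hole of length at least `2ℓ+3`. -/
def SimpleGraph.MemGFamily {V : Type*} (G : SimpleGraph V) (l : ℕ) : Prop :=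
  G.egirth = (2 * l + 1 : ℕ) ∧ ∀ n : ℕ, Odd n → 2 * l + 3 ≤ n → ¬ G.HasHole n

/-- `G ∈ 𝒢₀`: `G ∈ 𝒢₂`, `χ(G) = 4`, and every proper subgraph of `G` is 3-colorable. -/
def SimpleGraph.MemG0 {V : Type*} (G : SimpleGraph V) : Prop :=
  G.MemGFamily 2 ∧ G.chromaticNumber = 4 ∧
    ∀ H : G.Subgraph, H ≠ ⊤ → H.coe.Colorable 3

/-- `θ⁺`: the graph on `v0, …, v7` consisting of the 8-cycle `v0v1v2v3v4v5v6v7v0`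
together with the chords `v0v4` and `v2v6` (the Petersen graph minus two adjacent
vertices). -/
def thetaPlus : SimpleGraph (Fin 8) :=
  SimpleGraph.fromRel (fun a b => b = a + 1 ∨ (a = 0 ∧ b = 4) ∨ (a = 2 ∧ b = 6))

/-! ### Basic data extracted from membership in the family -/

/-- The working hypotheses: no short cycles, no long odd holes, vertex-critical. -/
structure Pent {V : Type*} (G : SimpleGraph V) : Prop where
  tri : ∀ a b c, G.Adj a b → G.Adj b c → G.Adj a c → False
  quad : ∀ a b c d, a ≠ c → b ≠ d → G.Adj a b → G.Adj b c → G.Adj c d → G.Adj d a → False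
  hole : ∀ (N : ℕ) (c : ℕ → V), Odd N → 7 ≤ N →
    (∀ i j, i < j → j < N → (c i ≠ c j ∧
      (G.Adj (c i) (c j) ↔ (i + 1 = j ∨ (i = 0 ∧ j + 1 = N))))) → False
  crit : ∀ S : Set V, S ≠ Set.univ → ∃ f : V → Fin 3, ∀ a ∈ S, ∀ b ∈ S, G.Adj a b → f a ≠ f b
  ncol : ¬ ∃ f : V → Fin 3, ∀ a b, G.Adj a b → f a ≠ f b

theorem cyc_adj_aux {n : ℕ} {u v : Fin (n + 3)} (h : (cycleGraph (n + 3)).Adj u v) (huv : u < v) :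
    u.val + 1 = v.val ∨ (u.val = 0 ∧ v.val + 1 = n + 3) := by
  rw [cycleGraph_adj'] at h
  obtain ⟨u, hu⟩ := u
  obtain ⟨v, hv⟩ := v
  have huv' : u < v := huv
  rcases h with h | h
  · rw [Fin.sub_def] at h
    simp only at h
    rw [Nat.mod_eq_of_lt (by omega)] at h
    simp only
    omega
  · rw [Fin.sub_val_of_le (le_of_lt huv)] at h
    simp only at h ⊢
    omega

theorem cyc_hom {V : Type*} {G : SimpleGraph V} (n : ℕ) (c : ℕ → V)
    (hadj : ∀ i, i + 1 < n + 3 → G.Adj (c i) (c (i+1))) (hlast : G.Adj (c 0) (c (n+2)))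
    {u v : Fin (n+3)} (h : (cycleGraph (n + 3)).Adj u v) : G.Adj (c u) (c v) := by
  have key : ∀ {u v : Fin (n+3)}, (cycleGraph (n + 3)).Adj u v → u < v → G.Adj (c u) (c v) := by
    intro u v h huv
    have hv := v.2
    rcases cyc_adj_aux h huv with h1 | ⟨h1, h2⟩
    · have := hadj u.val (by omega)
      rwa [h1] at this
    · have h3 : v.val = n + 2 := by omega
      rw [h1, h3]; exact hlast
  rcases lt_trichotomy u v with h1 | h1 | h1
  · exact key h h1
  · subst h1; exact absurd h (SimpleGraph.irrefl _)
  · exact (key h.symm h1).symm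

theorem cyc_walk {V : Type*} {G : SimpleGraph V} (n : ℕ) (c : ℕ → V)
    (hinj : ∀ i j, i < j → j < n + 3 → c i ≠ c j)
    (hadj : ∀ i, i + 1 < n + 3 → G.Adj (c i) (c (i+1))) (hlast : G.Adj (c 0) (c (n+2))) :
    ∃ (v : V) (w : G.Walk v v), w.IsCycle ∧ w.length = n + 3 ∧
      (∀ u, u ∈ w.support → ∃ i, i < n + 3 ∧ u = c i) ∧
      (∀ i, i + 1 < n + 3 → w.toSubgraph.Adj (c i) (c (i+1))) ∧
      w.toSubgraph.Adj (c 0) (c (n+2)) := by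
  let f : cycleGraph (n+3) →g G := ⟨fun u => c u.val, fun h => cyc_hom n c hadj hlast h⟩
  have hf : Function.Injective f := by
    intro u v huv
    change c u.val = c v.val at huv
    rcases lt_trichotomy u v with h1 | h1 | h1
    · exact absurd huv (hinj _ _ h1 v.2)
    · exact h1
    · exact absurd huv.symm (hinj _ _ h1 u.2)
  have hw : ∀ m, m < n + 3 → ((cycleGraph.cycle n).map f).toSubgraph.Adj
      (c ((n + 3 - m) % (n + 3))) (c ((n + 3 - (m+1)) % (n + 3))) := by
    intro m hm
    have := ((cycleGraph.cycle n).map f).toSubgraph_adj_getVert (i := m) (by simpa using hm)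
    rw [Walk.getVert_map, Walk.getVert_map, cycleGraph.getVert_cycle (by omega),
      cycleGraph.getVert_cycle (by omega)] at this
    exact this
  refine ⟨_, (cycleGraph.cycle n).map f, ?_, ?_, ?_, ?_, ?_⟩
  · exact (Walk.isCycle_map_iff_of_injective hf).mpr cycleGraph.isCycle_cycle
  · simp
  · intro u hu
    rw [Walk.support_map, List.mem_map] at hu
    obtain ⟨a, _, rfl⟩ := hu
    exact ⟨a.val, a.2, rfl⟩
  · intro i hi
    have := hw (n + 2 - i) (by omega)
    rw [show n + 3 - (n + 2 - i) = i + 1 by omega, show n + 3 - (n + 2 - i + 1) = i by omega,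
      Nat.mod_eq_of_lt (by omega), Nat.mod_eq_of_lt (by omega)] at this
    exact this.symm
  · have := hw 0 (by omega)
    rw [show n + 3 - 0 = n + 3 by omega, show n + 3 - (0+1) = n + 2 by omega,
      Nat.mod_self, Nat.mod_eq_of_lt (by omega)] at this
    exact this

theorem pent_of_mem {V : Type*} {G : SimpleGraph V} (hG : G.MemG0) : Pent G := by
  obtain ⟨⟨hg, hh⟩, hchi, hcr⟩ := hG
  have girth : ∀ (n : ℕ) (c : ℕ → V), n < 2 →
      (∀ i j, i < j → j < n + 3 → c i ≠ c j) →
      (∀ i, i + 1 < n + 3 → G.Adj (c i) (c (i+1))) → G.Adj (c 0) (c (n+2)) → False := by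
    intro n c hn h1 h2 h3
    obtain ⟨v, w, hw, hl, _⟩ := cyc_walk n c h1 h2 h3
    have := egirth_le_length hw
    rw [hg, hl] at this
    have : 2 * 2 + 1 ≤ n + 3 := by exact_mod_cast this
    omega
  refine ⟨?_, ?_, ?_, ?_, ?_⟩
  · intro a b c hab hbc hac
    refine girth 0 (fun i => if i = 0 then a else if i = 1 then b else c) (by omega) ?_ ?_ ?_
    · intro i j hij hj
      have h1 := hab.ne
      have h2 := hbc.ne
      have h3 := hac.ne
      interval_cases j <;> interval_cases i <;> simp [h1, h2, h3]
    · intro i hi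
      have : i < 2 := by omega
      interval_cases i <;> simp [hab, hbc]
    · simp [hac]
  · intro a b c d hac hbd hab hbc hcd hda
    refine girth 1 (fun i => if i = 0 then a else if i = 1 then b else if i = 2 then c else d)
      (by omega) ?_ ?_ ?_
    · intro i j hij hj
      have h1 := hab.ne
      have h2 := hbc.ne
      have h3 := hcd.ne
      have h4 := hda.ne'
      interval_cases j <;> interval_cases i <;> simp [h1, h2, h3, h4, hac, hbd]
    · intro i hi
      have : i < 3 := by omega
      interval_cases i <;> simp [hab, hbc, hcd]
    · simpa using hda.symm
  · intro N c hodd hN hc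
    obtain ⟨n, rfl⟩ : ∃ n, N = n + 3 := ⟨N - 3, by omega⟩
    obtain ⟨v, w, hw, hl, hsup, ha, hlast⟩ := cyc_walk n c (fun i j h1 h2 => (hc i j h1 h2).1)
      (fun i hi => (hc i (i+1) (by omega) hi).2.2 (Or.inl rfl))
      ((hc 0 (n+2) (by omega) (by omega)).2.2 (Or.inr ⟨rfl, rfl⟩))
    refine hh (n+3) hodd (by omega) ⟨by omega, v, w, hw, ?_, hl⟩
    have key : ∀ i j, i < j → j < n + 3 → G.Adj (c i) (c j) → w.toSubgraph.Adj (c i) (c j) := by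
      intro i j hij hj h
      rcases (hc i j hij hj).2.1 h with h1 | ⟨h1, h2⟩
      · subst h1; exact ha i hj
      · have h3 : j = n + 2 := by omega
        subst h1; subst h3; exact hlast
    intro a ha' b hb' hab
    rw [Walk.mem_verts_toSubgraph] at ha' hb'
    obtain ⟨i, hi, rfl⟩ := hsup _ ha'
    obtain ⟨j, hj, rfl⟩ := hsup _ hb'
    rcases lt_trichotomy i j with h1 | h1 | h1
    · exact key i j h1 hj hab
    · subst h1; exact absurd hab (SimpleGraph.irrefl _)
    · exact (key j i h1 hi hab.symm).symm
  · intro S hS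
    have h1 : (⊤ : G.Subgraph).induce S ≠ ⊤ := by
      intro h
      apply hS
      have := congrArg Subgraph.verts h
      simpa using this
    obtain ⟨f⟩ := hcr _ h1
    classical
    refine ⟨fun v => if hv : v ∈ S then f ⟨v, hv⟩ else 0, ?_⟩
    intro a ha b hb hab
    simp only [ha, hb, dif_pos]
    apply f.valid
    simp [ha, hb, hab]
  · rintro ⟨f, hf⟩
    have h1 : G.Colorable 3 := ⟨Coloring.mk f (fun {a b} h => hf a b h)⟩
    have h2 := h1.chromaticNumber_le
    rw [hchi] at h2
    have : 4 ≤ 3 := by exact_mod_cast h2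
    omega

/-! ### Induced paths as functions, connected sets -/

section Paths

variable {V : Type*} {G : SimpleGraph V}

/-- `p 0, …, p n` is an induced path. -/
def IP (G : SimpleGraph V) (n : ℕ) (p : ℕ → V) : Prop :=
  ∀ i j, i < j → j ≤ n → p i ≠ p j ∧ (G.Adj (p i) (p j) ↔ i + 1 = j)

theorem two_paths (hP : Pent G) {n m : ℕ} {p q : ℕ → V} (hp : IP G n p) (hq : IP G m q)
    (h0 : p 0 = q 0) (h1 : p n = q m) (hn : 2 ≤ n) (hm : 2 ≤ m)
    (hac : ∀ i j, 0 < i → i < n → 0 < j → j < m → p i ≠ q j ∧ ¬ G.Adj (p i) (q j))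
    (hodd : Odd (n + m)) (h7 : 7 ≤ n + m) : False := by
  refine hP.hole (n + m) (fun k => if k ≤ n then p k else q (n + m - k)) hodd h7 ?_
  intro i j hij hj
  by_cases hjn : j ≤ n
  · have hin : i ≤ n := by omega
    simp only [hjn, hin, if_true]
    have := hp i j hij hjn
    refine ⟨this.1, this.2.trans ?_⟩
    omega
  · by_cases hin : i ≤ n
    · simp only [hjn, hin, if_true, if_false]
      rcases Nat.eq_zero_or_pos i with hi | hi
      · subst hi
        rw [h0]
        have := hq 0 (n + m - j) (by omega) (by omega)
        refine ⟨this.1, this.2.trans ?_⟩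
        omega
      · rcases Nat.lt_or_ge i n with hi2 | hi2
        · have := hac i (n + m - j) hi hi2 (by omega) (by omega)
          refine ⟨this.1, ?_⟩
          constructor
          · intro h; exact absurd h this.2
          · intro h; omega
        · have hi3 : i = n := by omega
          subst hi3
          rw [h1]
          have := hq (i + m - j) m (by omega) (by omega)
          refine ⟨this.1.symm, (G.adj_comm _ _).trans (this.2.trans ?_)⟩
          omega
    · simp only [hjn, hin, if_false]
      have := hq (n + m - j) (n + m - i) (by omega) (by omega)
      refine ⟨this.1.symm, (G.adj_comm _ _).trans (this.2.trans ?_)⟩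
      omega

/-- A walk inside `S` of length `m`. -/
def WalkIn (G : SimpleGraph V) (S : Set V) (a b : V) (m : ℕ) : Prop :=
  ∃ w : ℕ → V, w 0 = a ∧ w m = b ∧ (∀ k, k < m → G.Adj (w k) (w (k+1))) ∧ ∀ k, k ≤ m → w k ∈ S

theorem WalkIn.snoc {S : Set V} {a b c : V} {m : ℕ} (h : WalkIn G S a b m) (hbc : G.Adj b c)
    (hc : c ∈ S) : WalkIn G S a c (m+1) := by
  obtain ⟨w, h0, hm, ha, hS⟩ := h
  refine ⟨fun k => if k ≤ m then w k else c, by simp [h0], by simp, ?_, ?_⟩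
  · intro k hk
    rcases Nat.lt_or_ge k m with h1 | h1
    · have h2 : k ≤ m := by omega
      have h3 : k + 1 ≤ m := by omega
      simp only [h2, h3, if_true]
      exact ha k h1
    · have h2 : k = m := by omega
      subst h2
      simp [hm, hbc]
  · intro k hk
    by_cases h1 : k ≤ m
    · simp only [h1, if_true]; exact hS k h1
    · simp only [h1, if_false]; exact hc

theorem exists_IP {S : Set V} {a b : V} {m : ℕ} (h : WalkIn G S a b m) :
    ∃ n p, n ≤ m ∧ IP G n p ∧ p 0 = a ∧ p n = b ∧ ∀ k, k ≤ n → p k ∈ S := by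
  classical
  have hex : ∃ m, WalkIn G S a b m := ⟨m, h⟩
  have hle : Nat.find hex ≤ m := Nat.find_min' hex h
  have hmin : ∀ k, WalkIn G S a b k → Nat.find hex ≤ k := fun k hk => Nat.find_min' hex hk
  obtain ⟨w, h0, hm, ha, hS⟩ := Nat.find_spec hex
  generalize Nat.find hex = n at *
  -- shortcuts are impossible
  have short : ∀ i d, 0 < d → i + d < n → ¬ G.Adj (w i) (w (i + 1 + d)) := by
    intro i d hd hi hadj
    have : n ≤ n - d := by
      apply hmin
      refine ⟨fun k => if k ≤ i then w k else w (k + d), by simp [h0], ?_, ?_, ?_⟩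
      · have h1 : ¬ (n - d ≤ i) := by omega
        simp only [h1, if_false]
        rw [show n - d + d = n by omega]; exact hm
      · intro k hk
        by_cases h1 : k + 1 ≤ i
        · have h2 : k ≤ i := by omega
          simp only [h1, h2, if_true]
          exact ha k (by omega)
        · by_cases h2 : k ≤ i
          · have h3 : k = i := by omega
            subst h3
            simp only [le_refl, if_true, h1, if_false]
            exact hadj
          · simp only [h1, h2, if_false]
            rw [show k + 1 + d = k + d + 1 by omega]
            exact ha (k + d) (by omega)
      · intro k hk
        by_cases h1 : k ≤ i
        · simp only [h1, if_true]; exact hS k (by omega)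
        · simp only [h1, if_false]; exact hS (k + d) (by omega)
    omega
  have inj : ∀ i d, 0 < d → i + d ≤ n → w i ≠ w (i + d) := by
    intro i d hd hi heq
    rcases Nat.lt_or_ge (i + d) n with h1 | h1
    · apply short i d hd h1
      rw [heq, show i + 1 + d = i + d + 1 by omega]
      exact ha (i + d) h1
    · have : n ≤ i := by
        apply hmin
        refine ⟨w, h0, ?_, fun k hk => ha k (by omega), fun k hk => hS k (by omega)⟩
        rw [heq, show i + d = n by omega]; exact hm
      omega
  refine ⟨n, w, hle, ?_, h0, hm, hS⟩
  intro i j hij hj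
  refine ⟨?_, ?_, ?_⟩
  · have := inj i (j - i) (by omega) (by omega)
    rwa [show i + (j - i) = j by omega] at this
  · intro h
    by_contra hne
    apply short i (j - i - 1) (by omega) (by omega)
    rwa [show i + 1 + (j - i - 1) = j by omega]
  · intro h
    subst h
    exact ha i (by omega)

/-- Reachability inside `S`. -/
def Rch (G : SimpleGraph V) (S : Set V) (a b : V) : Prop :=
  Relation.ReflTransGen (fun u v => G.Adj u v ∧ u ∈ S ∧ v ∈ S) a b

theorem Rch.symm {S : Set V} {a b : V} (h : Rch G S a b) : Rch G S b a := by
  unfold Rch at h ⊢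
  induction h with
  | refl => exact Relation.ReflTransGen.refl
  | tail _ h ih => exact Relation.ReflTransGen.head ⟨h.1.symm, h.2.2, h.2.1⟩ ih

theorem Rch.mono {S T : Set V} (hST : S ⊆ T) {a b : V} (h : Rch G S a b) : Rch G T a b := by
  unfold Rch at h ⊢
  induction h with
  | refl => exact Relation.ReflTransGen.refl
  | tail _ h ih => exact ih.tail ⟨h.1, hST h.2.1, hST h.2.2⟩

theorem Rch.trans {S : Set V} {a b c : V} (h : Rch G S a b) (h' : Rch G S b c) : Rch G S a c :=
  Relation.ReflTransGen.trans h h'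

theorem Rch.single {S : Set V} {a b : V} (h : G.Adj a b) (ha : a ∈ S) (hb : b ∈ S) :
    Rch G S a b := Relation.ReflTransGen.single ⟨h, ha, hb⟩

theorem Rch.walk {S : Set V} {a b : V} (ha : a ∈ S) (h : Rch G S a b) : ∃ m, WalkIn G S a b m := by
  induction h with
  | refl => exact ⟨0, fun _ => a, rfl, rfl, fun k hk => by omega, fun _ _ => ha⟩
  | tail _ h ih =>
    obtain ⟨m, hm⟩ := ih
    exact ⟨m + 1, hm.snoc h.1 h.2.2⟩

theorem Rch.mem {S : Set V} {a b : V} (ha : a ∈ S) (h : Rch G S a b) : b ∈ S := by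
  induction h with
  | refl => exact ha
  | tail _ h _ => exact h.2.2

/-- `F` is connected. -/
def Conn (G : SimpleGraph V) (F : Set V) : Prop := ∀ a ∈ F, ∀ b ∈ F, Rch G F a b

theorem conn_insert {F : Set V} (hF : Conn G F) {u v : V} (hv : v ∈ F) (h : G.Adj v u) :
    Conn G (insert u F) := by
  have key : ∀ a ∈ insert u F, Rch G (insert u F) v a := by
    rintro a (rfl | ha)
    · exact Rch.single h (Set.mem_insert_of_mem _ hv) (Set.mem_insert _ _)
    · exact (hF v hv a ha).mono (Set.subset_insert _ _)
  intro a ha b hb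
  exact (key a ha).symm.trans (key b hb)

/-- The component of `a` in `S`. -/
def comp (G : SimpleGraph V) (S : Set V) (a : V) : Set V := {b | Rch G S a b}

theorem comp_self {S : Set V} {a : V} : a ∈ comp G S a := Relation.ReflTransGen.refl

theorem comp_sub {S : Set V} {a : V} (ha : a ∈ S) : comp G S a ⊆ S := fun _ h => Rch.mem ha h

theorem comp_closed {S : Set V} {a b c : V} (ha : a ∈ S) (hb : b ∈ comp G S a) (hc : c ∈ S)
    (h : G.Adj b c) : c ∈ comp G S a :=
  Rch.trans hb (Rch.single h (comp_sub ha hb) hc)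

theorem comp_conn {S : Set V} {a : V} : Conn G (comp G S a) := by
  have key : ∀ b, Rch G S a b → Rch G (comp G S a) a b := by
    intro b h
    induction h with
    | refl => exact Relation.ReflTransGen.refl
    | tail h1 h2 ih =>
      exact ih.trans (Rch.single h2.1 h1 (Rch.trans h1 (Relation.ReflTransGen.single h2)))
  intro b hb c hc
  exact (key b hb).symm.trans (key c hc)

/-- If `F` is connected and `C` is the component of `a` in `F ∩ S` and is not everything,
then it has a neighbour in `F \ S`. -/
theorem comp_boundary {F S : Set V} (hF : Conn G F) {a b : V} (haF : a ∈ F) (haS : a ∈ S)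
    (hbF : b ∈ F) (hb : b ∉ comp G (F ∩ S) a) :
    ∃ c ∈ comp G (F ∩ S) a, ∃ d ∈ F, d ∉ S ∧ G.Adj c d := by
  by_contra hno
  push Not at hno
  apply hb
  have h := hF a haF b hbF
  clear hb hbF
  induction h with
  | refl => exact comp_self
  | tail _ h2 ih =>
    refine comp_closed ⟨haF, haS⟩ ih ⟨h2.2.2, ?_⟩ h2.1
    by_contra hS
    exact hno _ ih _ h2.2.2 hS h2.1

/-- An induced path from `x` to `y` through a connected set `F`. -/
theorem path_through {F : Set V} (hF : Conn G F) {x y u v : V}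
    (hxy : x ≠ y) (hnadj : ¬ G.Adj x y)
    (hu : u ∈ F) (hv : v ∈ F) (hxu : G.Adj x u) (hvy : G.Adj v y) :
    ∃ n p, 2 ≤ n ∧ IP G n p ∧ p 0 = x ∧ p n = y ∧ ∀ k, 0 < k → k < n → p k ∈ F := by
  have h1 : Rch G (F ∪ {x, y}) x y := by
    refine (Rch.single hxu (by simp) (by simp [hu])).trans
      (((hF u hu v hv).mono Set.subset_union_left).trans (Rch.single hvy (by simp [hv]) (by simp)))
  obtain ⟨m, hm⟩ := h1.walk (by simp)
  obtain ⟨n, p, _, hp, h0, hn, hS⟩ := exists_IP hm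
  have hn0 : n ≠ 0 := by
    rintro rfl
    exact hxy (h0.symm.trans hn)
  have hn1 : n ≠ 1 := by
    rintro rfl
    apply hnadj
    rw [← h0, ← hn]
    exact (hp 0 1 (by omega) (by omega)).2.2 rfl
  refine ⟨n, p, by omega, hp, h0, hn, ?_⟩
  intro k hk hkn
  rcases hS k hkn.le with h | h | h
  · exact h
  · exact absurd (h0.trans h.symm) (hp 0 k hk hkn.le).1
  · exact absurd (h.trans hn.symm) (hp k n hkn le_rfl).1

end Paths

/-! ### Star cutsets -/

section Star

variable {V : Type*} {G : SimpleGraph V}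

/-- Two-colour alternation along a path. -/
theorem alt_path {n : ℕ} {p : ℕ → V} {f : V → Fin 3}
    (hf : ∀ i, i < n → f (p i) ≠ f (p (i+1))) (h2 : ∀ i, i ≤ n → f (p i) ≠ 2) :
    f (p 0) = f (p n) ↔ Even n := by
  induction n with
  | zero => simp
  | succ n ih =>
    have h1 := ih (fun i hi => hf i (by omega)) (fun i hi => h2 i (by omega))
    have h3 := hf n (by omega)
    have h4 := h2 (n+1) le_rfl
    have h5 := h2 n (by omega)
    have h6 := h2 0 (by omega)
    rw [Nat.even_add_one, ← h1]
    generalize f (p 0) = a at *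
    generalize f (p n) = b at *
    generalize f (p (n+1)) = d at *
    clear ih hf h2 h1
    revert a b d
    decide

theorem kempe {S Y : Set V} {c : V} {f : V → Fin 3} {σ : V → Bool}
    (hf : ∀ a ∈ S, ∀ b ∈ S, G.Adj a b → f a ≠ f b) (hcS : c ∈ S) (hc : f c = 2)
    (hYS : Y ⊆ S) (hYc : ∀ y ∈ Y, G.Adj c y)
    (hpar : ∀ y ∈ Y, ∀ y' ∈ Y, y ≠ y' → ∀ n p, IP G n p → p 0 = y → p n = y' →
      (∀ k, k ≤ n → p k ∈ S) → (∀ k, 0 < k → k < n → p k ∉ Y ∧ p k ≠ c) →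
      (Even n ↔ σ y = σ y')) :
    ∃ f' : V → Fin 3, (∀ a ∈ S, ∀ b ∈ S, G.Adj a b → f' a ≠ f' b) ∧ f' c = 2 ∧
      ∀ y ∈ Y, f' y = if σ y then 1 else 0 := by
  classical
  set K : Set V := {v | v ∈ S ∧ f v ≠ 2} with hK
  have hYK : ∀ y ∈ Y, y ∈ K := fun y hy =>
    ⟨hYS hy, fun h => hf c hcS y (hYS hy) (hYc y hy) (hc.trans h.symm)⟩
  have claim : ∀ m, ∀ y ∈ Y, ∀ y' ∈ Y, WalkIn G K y y' m → (f y = f y' ↔ σ y = σ y') := by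
    intro m
    induction m using Nat.strong_induction_on with
    | _ m ih =>
      intro y hy y' hy' hw
      by_cases hyy : y = y'
      · subst hyy; simp
      obtain ⟨n, p, hnm, hp, h0, hn, hS⟩ := exists_IP hw
      by_cases hinter : ∃ k, 0 < k ∧ k < n ∧ p k ∈ Y
      · obtain ⟨k, hk0, hkn, hkY⟩ := hinter
        have h1 := ih k (by omega) y hy (p k) hkY
          ⟨p, h0, rfl, fun i hi => (hp i (i+1) (by omega) (by omega)).2.2 rfl,
            fun i hi => hS i (by omega)⟩
        have h2 := ih (n - k) (by omega) (p k) hkY y' hy'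
          ⟨fun i => p (k + i), rfl, by simp only; rw [show k + (n - k) = n by omega]; exact hn,
            fun i hi => (hp (k + i) (k + (i+1)) (by omega) (by omega)).2.2 (by omega),
            fun i hi => hS (k + i) (by omega)⟩
        have k1 := (hYK y hy).2
        have k2 := (hYK y' hy').2
        have k3 := (hYK (p k) hkY).2
        generalize f y = a at *
        generalize f y' = b at *
        generalize f (p k) = d at *
        generalize σ y = s at *
        generalize σ y' = t at *
        generalize σ (p k) = r at *
        clear ih hpar
        revert a b d s t r
        decide
      · push Not at hinter
        have h1 := hpar y hy y' hy' hyy n p hp h0 hn (fun k hk => (hS k hk).1)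
          (fun k hk hkn => ⟨hinter k hk hkn, fun h => (hS k hkn.le).2 (by rw [h, hc])⟩)
        rw [← h1, ← h0, ← hn]
        exact alt_path (p := p) (n := n) (fun i hi => hf _ (hS i (by omega)).1 _ (hS (i+1) (by omega)).1
          ((hp i (i+1) (by omega) (by omega)).2.2 rfl)) (fun i hi => (hS i hi).2)
  have claim' : ∀ y ∈ Y, ∀ y' ∈ Y, Rch G K y y' → (f y = f y' ↔ σ y = σ y') := by
    intro y hy y' hy' h
    obtain ⟨m, hm⟩ := h.walk (hYK y hy)
    exact claim m y hy y' hy' hm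
  let bad : V → Prop := fun v => ∃ y ∈ Y, Rch G K y v ∧ f y ≠ if σ y then 1 else 0
  refine ⟨fun v => if v ∈ K ∧ bad v then Equiv.swap 0 1 (f v) else f v, ?_, ?_, ?_⟩
  · intro a ha b hb hab
    have hne := hf a ha b hb hab
    by_cases hak : a ∈ K
    · by_cases hbk : b ∈ K
      · have hiff : bad a ↔ bad b := by
          constructor
          · rintro ⟨y, hy, h1, h2⟩
            exact ⟨y, hy, h1.trans (Rch.single hab hak hbk), h2⟩
          · rintro ⟨y, hy, h1, h2⟩
            exact ⟨y, hy, h1.trans (Rch.single hab.symm hbk hak), h2⟩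
        by_cases hbad : bad b
        · simp only [hak, hbk, hiff, hbad, and_self, if_true]
          intro h
          exact hne ((Equiv.swap 0 1).injective h)
        · simp only [hiff, hbad, and_false, if_false]
          exact hne
      · have hb2 : f b = 2 := by
          by_contra h; exact hbk ⟨hb, h⟩
        have ha2 := hak.2
        simp only [hbk, false_and, if_false, hb2]
        split_ifs
        · clear hne
          generalize f a = x at *
          revert x; decide
        · exact ha2
    · have ha2 : f a = 2 := by
        by_contra h; exact hak ⟨ha, h⟩
      simp only [hak, false_and, if_false, ha2]
      have hb2 : f b ≠ 2 := fun h => hne (ha2.trans h.symm)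
      split_ifs
      · clear hne
        generalize f b = x at *
        revert x; decide
      · exact hb2.symm
  · have : c ∉ K := fun h => h.2 hc
    simp only [this, false_and, if_false, hc]
  · intro y hy
    have hyK := hYK y hy
    by_cases hb : bad y
    · simp only [hyK, hb, and_self, if_true]
      obtain ⟨z, hz, h1, h2⟩ := hb
      have h3 := claim' z hz y hy h1
      have k1 := hyK.2
      have k2 := (hYK z hz).2
      generalize f y = a at *
      generalize f z = b at *
      generalize σ y = s at *
      generalize σ z = t at *
      clear claim claim' hpar
      revert a b s t
      decide
    · simp only [hb, and_false, if_false]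
      by_contra h
      exact hb ⟨y, hy, Relation.ReflTransGen.refl, h⟩

theorem len3 (hP : Pent G) {n : ℕ} {p : ℕ → V} {c y y' : V} (hp : IP G n p) (h0 : p 0 = y)
    (hn : p n = y') (hcy : G.Adj c y) (hcy' : G.Adj c y') (hne : y ≠ y')
    (hinter : ∀ k, 0 < k → k < n → p k ≠ c) : 3 ≤ n := by
  by_contra hlt
  have : n = 0 ∨ n = 1 ∨ n = 2 := by omega
  rcases this with rfl | rfl | rfl
  · exact hne (h0.symm.trans hn)
  · have := (hp 0 1 (by omega) (by omega)).2.2 rfl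
    rw [h0, hn] at this
    exact hP.tri c y y' hcy this hcy'
  · have h1 := (hp 0 1 (by omega) (by omega)).2.2 rfl
    have h2 := (hp 1 2 (by omega) (by omega)).2.2 rfl
    rw [h0] at h1
    rw [hn] at h2
    exact hP.quad y (p 1) y' c hne (hinter 1 (by omega) (by omega)) h1 h2 hcy'.symm hcy

theorem star_cut (hP : Pent G) {A : Set V} {c : V} (σ : V → Bool) (hA : Conn G A)
    (hAne : A.Nonempty) (hcA : c ∉ A)
    (hN : ∀ a ∈ A, ∀ y, y ∉ A → G.Adj a y → y = c ∨ G.Adj c y)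
    (hB : ∃ b, b ∉ A ∧ b ≠ c ∧ ∀ a ∈ A, ¬ G.Adj a b)
    (hσ : ∀ y y', y ∉ A → y' ∉ A → y ≠ y' → G.Adj c y → G.Adj c y' → (∃ a ∈ A, G.Adj a y) →
      (∃ a ∈ A, G.Adj a y') → ∃ l r, IP G l r ∧ r 0 = y ∧ r l = y' ∧
        (∀ k, 0 < k → k < l → r k ∉ A ∧ r k ≠ c ∧ ∀ a ∈ A, ¬ G.Adj a (r k)) ∧
        (Even l ↔ σ y = σ y')) : False := by
  classical
  set Y : Set V := {y | y ∉ A ∧ y ≠ c ∧ ∃ a ∈ A, G.Adj a y} with hY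
  set B : Set V := {b | b ∉ A ∧ b ≠ c ∧ ∀ a ∈ A, ¬ G.Adj a b} with hBdef
  have hYc : ∀ y ∈ Y, G.Adj c y := by
    rintro y ⟨h1, h2, a, ha, h3⟩
    exact (hN a ha y h1 h3).resolve_left h2
  have hnorm : ∀ S : Set V, S ≠ Set.univ → ∃ f : V → Fin 3,
      (∀ a ∈ S, ∀ b ∈ S, G.Adj a b → f a ≠ f b) ∧ f c = 2 := by
    intro S hS
    obtain ⟨f, hf⟩ := hP.crit S hS
    refine ⟨fun v => Equiv.swap (f c) 2 (f v), ?_, by simp⟩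
    intro a ha b hb hab h
    exact hf a ha b hb hab ((Equiv.swap (f c) 2).injective h)
  -- paths
  have anti : ∀ a ∈ A, ∀ b ∈ B, a ≠ b ∧ ¬ G.Adj a b := by
    intro a ha b hb
    exact ⟨fun h => hb.1 (h ▸ ha), hb.2.2 a ha⟩
  have bpath : ∀ y ∈ Y, ∀ y' ∈ Y, y ≠ y' → ∃ l r, 3 ≤ l ∧ IP G l r ∧ r 0 = y ∧ r l = y' ∧
      (∀ k, 0 < k → k < l → r k ∈ B) ∧ (Even l ↔ σ y = σ y') := by
    intro y hy y' hy' hne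
    obtain ⟨l, r, h1, h2, h3, h4, h5⟩ := hσ y y' hy.1 hy'.1 hne (hYc y hy) (hYc y' hy')
      hy.2.2 hy'.2.2
    exact ⟨l, r, len3 hP h1 h2 h3 (hYc y hy) (hYc y' hy') hne (fun k hk hkl => (h4 k hk hkl).2.1),
      h1, h2, h3, h4, h5⟩
  have apath : ∀ y ∈ Y, ∀ y' ∈ Y, y ≠ y' → ∃ l r, 3 ≤ l ∧ IP G l r ∧ r 0 = y ∧ r l = y' ∧
      (∀ k, 0 < k → k < l → r k ∈ A) := by
    intro y hy y' hy' hne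
    obtain ⟨_, _, a, ha, hay⟩ := hy
    obtain ⟨_, _, a', ha', hay'⟩ := hy'
    obtain ⟨l, r, h1, h2, h3, h4, h5⟩ := path_through hA hne
      (fun h => hP.tri c y y' (hYc y ⟨by assumption, by assumption, a, ha, hay⟩) h
        (hYc y' ⟨by assumption, by assumption, a', ha', hay'⟩)) ha ha' hay.symm hay'
    exact ⟨l, r, len3 hP h2 h3 h4 (hYc y ⟨by assumption, by assumption, a, ha, hay⟩)
      (hYc y' ⟨by assumption, by assumption, a', ha', hay'⟩) hne
      (fun k hk hkl h => hcA (h ▸ h5 k hk hkl)), h2, h3, h4, h5⟩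
  obtain ⟨f₀, hf₀, hfc₀⟩ := hnorm Aᶜ (by
    intro h
    obtain ⟨a, ha⟩ := hAne
    have : a ∈ Aᶜ := h ▸ Set.mem_univ a
    exact this ha)
  obtain ⟨g₀, hg₀, hgc₀⟩ := hnorm Bᶜ (by
    intro h
    obtain ⟨b, hb⟩ := hB
    have : b ∈ Bᶜ := h ▸ Set.mem_univ b
    exact this hb)
  have comb : ∀ y ∈ Y, ∀ y' ∈ Y, ∀ n m p q, 3 ≤ n → 3 ≤ m → IP G n p → IP G m q → p 0 = y →
      p n = y' → q 0 = y → q m = y' → (∀ k, 0 < k → k < n → p k ∈ A) →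
      (∀ k, 0 < k → k < m → q k ∈ B) → (Even n ↔ Even m) := by
    intro y _ y' _ n m p q hn hm hp hq h1 h2 h3 h4 h5 h6
    have : ¬ Odd (n + m) := by
      intro hodd
      refine two_paths hP hp hq (h1.trans h3.symm) (h2.trans h4.symm) (by omega) (by omega) ?_
        hodd ?_
      · intro i j hi hin hj hjm
        exact anti _ (h5 i hi hin) _ (h6 j hj hjm)
      · rcases hodd with ⟨t, ht⟩
        omega
    rw [Nat.not_odd_iff_even, Nat.even_add] at this
    exact this
  obtain ⟨f, hf, hfc, hfY⟩ := kempe (S := Aᶜ) (Y := Y) (σ := σ) hf₀ hcA hfc₀ (fun y hy => hy.1) hYc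
    (by
      intro y hy y' hy' hne n p hp h0 hn hS hinter
      obtain ⟨l, r, hl, hr, hr0, hrl, hrB, hpar⟩ := bpath y hy y' hy' hne
      obtain ⟨m, q, hm, hq, hq0, hqm, hqA⟩ := apath y hy y' hy' hne
      have hn3 := len3 hP hp h0 hn (hYc y hy) (hYc y' hy') hne (fun k hk hkn => (hinter k hk hkn).2)
      rw [← hpar, ← comb y hy y' hy' m l q r hm hl hq hr hq0 hqm hr0 hrl hqA hrB]
      refine (comb y hy y' hy' m n q p hm hn3 hq hp hq0 hqm h0 hn hqA ?_).symm
      intro k hk hkn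
      refine ⟨hS k hkn.le, (hinter k hk hkn).2, ?_⟩
      intro a ha hadj
      exact (hinter k hk hkn).1 ⟨hS k hkn.le, (hinter k hk hkn).2, a, ha, hadj⟩)
  obtain ⟨g, hg, hgc, hgY⟩ := kempe (S := Bᶜ) (Y := Y) (σ := σ) hg₀ (fun h => h.2.1 rfl) hgc₀
    (fun y hy h => by obtain ⟨_, _, a, ha, hay⟩ := hy; exact h.2.2 a ha hay) hYc
    (by
      intro y hy y' hy' hne n p hp h0 hn hS hinter
      obtain ⟨l, r, hl, hr, hr0, hrl, hrB, hpar⟩ := bpath y hy y' hy' hne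
      have hn3 := len3 hP hp h0 hn (hYc y hy) (hYc y' hy') hne (fun k hk hkn => (hinter k hk hkn).2)
      rw [← hpar]
      refine comb y hy y' hy' n l p r hn3 hl hp hr h0 hn hr0 hrl ?_ hrB
      intro k hk hkn
      by_contra hkA
      refine hS k hkn.le ⟨hkA, (hinter k hk hkn).2, ?_⟩
      intro a ha hadj
      exact (hinter k hk hkn).1 ⟨hkA, (hinter k hk hkn).2, a, ha, hadj⟩)
  have hmix : ∀ a ∈ A, ∀ b, b ∉ A → G.Adj a b → g a ≠ f b := by
    intro a ha b hb hab
    have hbB : b ∈ Bᶜ := fun h => h.2.2 a ha hab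
    have haB : a ∈ Bᶜ := fun h => h.1 ha
    have h1 := hg a haB b hbB hab
    by_cases hbc : b = c
    · subst hbc
      rw [hfc, ← hgc]; exact h1
    · have hbY : b ∈ Y := ⟨hb, hbc, a, ha, hab⟩
      rw [hfY b hbY, ← hgY b hbY]; exact h1
  refine hP.ncol ⟨fun v => if v ∈ A then g v else f v, ?_⟩
  intro a b hab
  by_cases ha : a ∈ A
  · by_cases hb : b ∈ A
    · simp only [ha, hb, if_true]
      exact hg a (fun h => h.1 ha) b (fun h => h.1 hb) hab
    · simp only [ha, hb, if_true, if_false]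
      exact hmix a ha b hb hab
  · by_cases hb : b ∈ A
    · simp only [ha, hb, if_true, if_false]
      exact (hmix b hb a ha hab.symm).symm
    · simp only [ha, hb, if_false]
      exact hf a ha b hb hab

end Star

/-! ### Templates -/

section Templates

variable {V : Type*} {G : SimpleGraph V}

/-- `h` embeds the graph with adjacency table `M` as an induced subgraph. -/
structure Emb (G : SimpleGraph V) {k : ℕ} (M : Fin k → Fin k → Bool) (h : Fin k → V) : Prop where
  inj : ∀ i j, h i = h j → i = j
  adj : ∀ i j, G.Adj (h i) (h j) ↔ M i j = true

/-- Verified test that the list `l` is an induced path of length `n` from `x` to `y` with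
interior avoiding `T`. -/
def goodPath {k : ℕ} (M : Fin k → Fin k → Bool) (T : Fin k → Bool) (x y : Fin k) (n : ℕ)
    (l : List (Fin k)) : Bool :=
  (l.getD 0 x == x) && (l.getD n x == y) && (List.range (n+1)).all fun i =>
    (i == 0 || Nat.ble n i || !(T (l.getD i x))) && (List.range (n+1)).all fun j =>
      Nat.ble j i || (!(l.getD i x == l.getD j x) &&
        ((M (l.getD i x) (l.getD j x)) == (i + 1 == j)))

/-- Search for induced paths (the list holds the path built so far, reversed). -/
def grow {k : ℕ} (M : Fin k → Fin k → Bool) (T : Fin k → Bool) (y : Fin k) :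
    ℕ → Fin k → List (Fin k) → List (List (Fin k))
  | 0, a, l => if a == y then [(a :: l).reverse] else []
  | n+1, a, l => (List.finRange k).flatMap fun v =>
      if M a v && !(l.any fun w => M w v || w == v) && ((n == 0) || !(T v))
      then grow M T y n v (a :: l) else []

/-- There is an induced path of length `n`. -/
def hasPath {k : ℕ} (M : Fin k → Fin k → Bool) (T : Fin k → Bool) (x y : Fin k) (n : ℕ) : Bool :=
  (grow M T y n x []).any (goodPath M T x y n)

/-- Induced paths of both parities. -/
def chk {k : ℕ} (M : Fin k → Fin k → Bool) (T : Fin k → Bool) (x y : Fin k) : Bool :=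
  (hasPath M T x y 3 || hasPath M T x y 5) && (hasPath M T x y 4 || hasPath M T x y 6)

theorem hasPath_spec {k : ℕ} {M : Fin k → Fin k → Bool} {h : Fin k → V} (hE : Emb G M h)
    {T : Fin k → Bool} {x y : Fin k} {n : ℕ} (hh : hasPath M T x y n = true) :
    ∃ p : ℕ → Fin k, IP G n (fun i => h (p i)) ∧ p 0 = x ∧ p n = y ∧
      ∀ i, 0 < i → i < n → T (p i) = false := by
  unfold hasPath at hh
  rw [List.any_eq_true] at hh
  obtain ⟨l, _, hl⟩ := hh
  unfold goodPath at hl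
  simp only [Bool.and_eq_true, beq_iff_eq, List.all_eq_true, List.mem_range, Bool.or_eq_true,
    Bool.not_eq_true', Nat.ble_eq, beq_eq_false_iff_ne] at hl
  obtain ⟨⟨h0, hn⟩, hall⟩ := hl
  refine ⟨fun i => l.getD i x, ?_, h0, hn, ?_⟩
  · intro i j hij hj
    have := ((hall i (by omega)).2 j (by omega)).resolve_left (by omega)
    refine ⟨fun hc => this.1 (hE.inj _ _ hc), ?_⟩
    rw [hE.adj, this.2]
    simp
  · intro i hi hin
    exact (hall i (by omega)).1.resolve_left (by omega)

theorem path_K (hP : Pent G) {k : ℕ} {M : Fin k → Fin k → Bool} {h : Fin k → V} (hE : Emb G M h)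
    {T : Fin k → Bool} {x y : Fin k} (hchk : chk M T x y = true) {n : ℕ} {p : ℕ → V}
    (hp : IP G n p) (h0 : p 0 = h x) (hn : p n = h y) (h3 : 3 ≤ n)
    (hout : ∀ i, 0 < i → i < n → ∀ z, p i ≠ h z)
    (hT : ∀ i, 0 < i → i < n → ∀ z, G.Adj (p i) (h z) → T z = true) : False := by
  have key : ∀ m, 2 ≤ m → Odd (n + m) → 7 ≤ n + m → hasPath M T x y m = true → False := by
    intro m hm hodd h7 hh
    obtain ⟨q, hq, hq0, hqm, hqT⟩ := hasPath_spec hE hh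
    refine two_paths hP hp hq (by rw [h0, hq0]) (by rw [hn, hqm]) (by omega) hm ?_ hodd h7
    intro i j hi hin hj hjm
    refine ⟨hout i hi hin _, fun hadj => ?_⟩
    have h1 := hT i hi hin _ hadj
    rw [hqT j hj hjm] at h1
    exact Bool.noConfusion h1
  unfold chk at hchk
  simp only [Bool.and_eq_true, Bool.or_eq_true] at hchk
  rcases Nat.even_or_odd n with he | ho
  · have he' := he
    obtain ⟨t, ht⟩ := he'
    rcases hchk.1 with h1 | h1
    · exact key 3 (by omega) (he.add_odd (by decide)) (by omega) h1
    · exact key 5 (by omega) (he.add_odd (by decide)) (by omega) h1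
  · rcases hchk.2 with h1 | h1
    · exact key 4 (by omega) (ho.add_even (by decide)) (by omega) h1
    · exact key 6 (by omega) (ho.add_even (by decide)) (by omega) h1

theorem IP.rev {n : ℕ} {p : ℕ → V} (hp : IP G n p) : IP G n (fun i => p (n - i)) := by
  intro i j hij hj
  have := hp (n - j) (n - i) (by omega) (by omega)
  refine ⟨this.1.symm, (G.adj_comm _ _).trans (this.2.trans ?_)⟩
  omega

/-- An outside path joining two nonadjacent template vertices. -/
structure GoodP (G : SimpleGraph V) {k : ℕ} (M : Fin k → Fin k → Bool) (h : Fin k → V)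
    (x y : Fin k) (n : ℕ) (p : ℕ → V) : Prop where
  ne : x ≠ y
  nadj : M x y = false
  two : 2 ≤ n
  ip : IP G n p
  p0 : p 0 = h x
  pn : p n = h y
  out : ∀ i, 0 < i → i < n → ∀ z, p i ≠ h z

theorem Emb.symm {k : ℕ} {M : Fin k → Fin k → Bool} {h : Fin k → V} (hE : Emb G M h) (x y : Fin k) :
    M x y = M y x := by
  rw [Bool.eq_iff_iff, ← hE.adj, ← hE.adj, G.adj_comm]

theorem Emb.nadj {k : ℕ} {M : Fin k → Fin k → Bool} {h : Fin k → V} (hE : Emb G M h) {x y : Fin k}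
    (hm : M x y = false) : ¬ G.Adj (h x) (h y) := by
  rw [hE.adj, hm]; simp

theorem GoodP.rev {k : ℕ} {M : Fin k → Fin k → Bool} {h : Fin k → V} (hE : Emb G M h)
    {x y : Fin k} {n : ℕ} {p : ℕ → V} (hg : GoodP G M h x y n p) :
    GoodP G M h y x n (fun i => p (n - i)) where
  ne := hg.ne.symm
  nadj := (hE.symm y x).trans hg.nadj
  two := hg.two
  ip := hg.ip.rev
  p0 := hg.pn
  pn := by simpa using hg.p0
  out := fun i hi hin => hg.out (n - i) (by omega) (by omega)

theorem min_side (hP : Pent G) {k : ℕ} {M : Fin k → Fin k → Bool} {h : Fin k → V} (hE : Emb G M h)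
    {n : ℕ} (hmin : ∀ m x y p, GoodP G M h x y m p → n ≤ m) {x y : Fin k} {p : ℕ → V}
    (hg : GoodP G M h x y n p) (h3 : 3 ≤ n) {i : ℕ} (hi : 0 < i) (hin : i < n) {z : Fin k}
    (hz : G.Adj (p i) (h z)) (hzx : z ≠ x) (hzy : z ≠ y) : M z x = true := by
  by_contra hM
  rw [Bool.not_eq_true] at hM
  have hw : WalkIn G ({v | ∀ z, v ≠ h z} ∪ {h x, h z}) (h x) (h z) (i+1) := by
    refine WalkIn.snoc (b := p i) ⟨p, hg.p0, rfl, ?_, ?_⟩ hz (by simp)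
    · intro j hj
      exact (hg.ip j (j+1) (by omega) (by omega)).2.2 rfl
    · intro j hj
      rcases Nat.eq_zero_or_pos j with h0 | h0
      · subst h0; rw [hg.p0]; simp
      · exact Or.inl (hg.out j h0 (by omega))
  obtain ⟨m, q, hm, hq, hq0, hqm, hS⟩ := exists_IP hw
  have hm0 : m ≠ 0 := by
    rintro rfl
    exact hzx (hE.inj _ _ (hqm.symm.trans hq0))
  have hm1 : m ≠ 1 := by
    rintro rfl
    have := (hq 0 1 (by omega) (by omega)).2.2 rfl
    rw [hq0, hqm] at this
    exact hE.nadj hM this.symm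
  have hle := hmin m x z q ⟨hzx.symm, (hE.symm x z).trans hM, by omega, hq, hq0, hqm, by
    intro j hj hjm
    rcases hS j hjm.le with hh | hh | hh
    · exact hh
    · exact absurd (hq0.trans hh.symm) (hq 0 j hj hjm.le).1
    · exact absurd (hh.trans hqm.symm) (hq j m hjm le_rfl).1⟩
  have hie : i = n - 1 := by omega
  have hy : G.Adj (p i) (h y) := by
    rw [← hg.pn]
    exact (hg.ip i n (by omega) le_rfl).2.2 (by omega)
  have hMy : M y z = false := by
    rw [← Bool.not_eq_true, ← hE.adj]
    exact fun hh => hP.tri _ _ _ hy hh hz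
  have hout := hg.out i hi hin
  have := hmin 2 y z (fun j => if j = 0 then h y else if j = 1 then p i else h z)
    ⟨hzy.symm, hMy, le_rfl, by
      intro a b hab hb
      have : (a = 0 ∧ b = 1) ∨ (a = 0 ∧ b = 2) ∨ (a = 1 ∧ b = 2) := by omega
      rcases this with ⟨rfl, rfl⟩ | ⟨rfl, rfl⟩ | ⟨rfl, rfl⟩
      · simp [hy.symm, (hout y).symm]
      · simp only [if_true, OfNat.ofNat_ne_zero, if_false, OfNat.ofNat_ne_one]
        exact ⟨fun hh => hzy (hE.inj _ _ hh).symm, by simp [hE.nadj hMy]⟩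
      · simp [hz, hout z], by simp, by simp, by
      intro j hj hj2
      have : j = 1 := by omega
      subst this
      simpa using hout⟩
  omega

theorem templ_ex (hP : Pent G) {k : ℕ} {M : Fin k → Fin k → Bool} {h : Fin k → V} (hE : Emb G M h)
    (hcol : ∃ f : Fin k → Fin 3, ∀ i j, M i j = true → f i ≠ f j) {x₀ y₀ : Fin k} (h₀ : x₀ ≠ y₀)
    (h₁ : M x₀ y₀ = false) : ∃ n x y p, GoodP G M h x y n p := by
  have hout : ∃ a : V, ∀ z, a ≠ h z := by
    by_contra hno
    push Not at hno
    choose e he using hno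
    obtain ⟨f, hf⟩ := hcol
    refine hP.ncol ⟨fun v => f (e v), fun a b hab => hf _ _ ?_⟩
    rw [← hE.adj, ← he, ← he]; exact hab
  obtain ⟨a, ha⟩ := hout
  set S : Set V := {v | ∀ z, v ≠ h z} with hS
  have haS : a ∈ S := ha
  set A := comp G S a with hA
  have hAS : A ⊆ S := comp_sub haS
  have hAh : ∀ z, h z ∉ A := fun z hz => hAS hz z rfl
  have hN : ∀ b ∈ A, ∀ y, y ∉ A → G.Adj b y → ∃ z, y = h z := by
    intro b hb y hy hby
    by_contra hno
    push Not at hno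
    exact hy (comp_closed haS hb hno hby)
  by_cases hatt : ∃ x y, x ≠ y ∧ M x y = false ∧ (∃ u ∈ A, G.Adj u (h x)) ∧ ∃ u ∈ A, G.Adj u (h y)
  · obtain ⟨x, y, hxy, hM, ⟨u, hu, hux⟩, v, hv, hvy⟩ := hatt
    obtain ⟨n, p, hn, hp, hp0, hpn, hpF⟩ := path_through (comp_conn (G := G) (S := S) (a := a))
      (fun hh => hxy (hE.inj _ _ hh)) (hE.nadj hM) hu hv hux.symm hvy
    exact ⟨n, x, y, p, hxy, hM, hn, hp, hp0, hpn, fun i hi hin => hAS (hpF i hi hin)⟩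
  · exfalso
    push Not at hatt
    have hatt' : ∀ x y, x ≠ y → ∀ u ∈ A, G.Adj u (h x) → ∀ v ∈ A, G.Adj v (h y) →
        G.Adj (h x) (h y) := by
      intro x y hxy u hu hux v hv hvy
      by_contra hh
      rw [hE.adj, Bool.not_eq_true] at hh
      exact hatt x y hxy hh ⟨u, hu, hux⟩ v hv hvy
    by_cases hi : ∃ i, ∃ u ∈ A, G.Adj u (h i)
    · obtain ⟨i, u, hu, hui⟩ := hi
      refine star_cut hP (A := A) (c := h i) (fun _ => true) comp_conn ⟨a, comp_self⟩ (hAh i) ?_ ?_ ?_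
      · intro b hb y hy hby
        obtain ⟨z, rfl⟩ := hN b hb y hy hby
        by_cases hzi : z = i
        · left; rw [hzi]
        · right; exact hatt' i z (Ne.symm hzi) u hu hui b hb hby
      · have : (∀ u ∈ A, ¬ G.Adj u (h x₀)) ∨ (∀ u ∈ A, ¬ G.Adj u (h y₀)) := by
          by_contra hh
          push Not at hh
          obtain ⟨⟨u, hu, hux⟩, v, hv, hvy⟩ := hh
          exact hatt x₀ y₀ h₀ h₁ ⟨u, hu, hux⟩ v hv hvy
        rcases this with hh | hh
        · exact ⟨h x₀, hAh _, fun he => hh u hu (he ▸ hui), hh⟩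
        · exact ⟨h y₀, hAh _, fun he => hh u hu (he ▸ hui), hh⟩
      · rintro y y' hy hy' hne hcy hcy' ⟨b, hb, hby⟩ ⟨b', hb', hby'⟩
        exfalso
        obtain ⟨z, rfl⟩ := hN b hb y hy hby
        obtain ⟨z', rfl⟩ := hN b' hb' y' hy' hby'
        exact hP.tri _ _ _ hcy (hatt' z z' (fun hh => hne (by rw [hh])) b hb hby b' hb' hby') hcy'
    · push Not at hi
      refine star_cut hP (A := A) (c := h x₀) (fun _ => true) comp_conn ⟨a, comp_self⟩ (hAh _)
        ?_ ?_ ?_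
      · intro b hb y hy hby
        obtain ⟨z, rfl⟩ := hN b hb y hy hby
        exact absurd hby (hi z b hb)
      · exact ⟨h y₀, hAh _, fun hh => h₀ (hE.inj _ _ hh).symm, hi y₀⟩
      · rintro y y' hy hy' hne hcy hcy' ⟨b, hb, hby⟩ _
        exfalso
        obtain ⟨z, rfl⟩ := hN b hb y hy hby
        exact hi z b hb hby

theorem templ (hP : Pent G) {k : ℕ} {M : Fin k → Fin k → Bool} {h : Fin k → V} (hE : Emb G M h)
    (hcol : ∃ f : Fin k → Fin 3, ∀ i j, M i j = true → f i ≠ f j) {x₀ y₀ : Fin k} (h₀ : x₀ ≠ y₀)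
    (h₁ : M x₀ y₀ = false) : ∃ n x y p, GoodP G M h x y n p ∧ (3 ≤ n → ∀ i, 0 < i → i < n →
      ∀ z, G.Adj (p i) (h z) → z = x ∨ z = y ∨ (M z x = true ∧ M z y = true)) := by
  classical
  have hex := templ_ex hP hE hcol h₀ h₁
  have hmin : ∀ m x y p, GoodP G M h x y m p → Nat.find hex ≤ m :=
    fun m x y p hh => Nat.find_min' hex ⟨x, y, p, hh⟩
  obtain ⟨x, y, p, hg⟩ := Nat.find_spec hex
  generalize Nat.find hex = n at *
  refine ⟨n, x, y, p, hg, ?_⟩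
  intro h3 i hi hin z hz
  by_cases hzx : z = x
  · exact Or.inl hzx
  by_cases hzy : z = y
  · exact Or.inr (Or.inl hzy)
  refine Or.inr (Or.inr ⟨min_side hP hE hmin hg h3 hi hin hz hzx hzy, ?_⟩)
  refine min_side hP hE hmin (hg.rev hE) h3 (i := n - i) (by omega) (by omega) ?_ hzy hzx
  rwa [show n - (n - i) = i by omega]

/-- Nonadjacent, distinct, without common neighbour. -/
def far {k : ℕ} (M : Fin k → Fin k → Bool) (x y : Fin k) : Bool :=
  !(x == y) && !(M x y) && !((List.finRange k).any fun z => M x z && M y z)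

theorem far_of (hP : Pent G) {k : ℕ} {M : Fin k → Fin k → Bool} {h : Fin k → V} (hE : Emb G M h)
    {u : V} (hu : ∀ z, u ≠ h z) {x y : Fin k} (hxy : x ≠ y) (hx : G.Adj u (h x))
    (hy : G.Adj u (h y)) : far M x y = true := by
  unfold far
  simp only [Bool.and_eq_true, Bool.not_eq_true', beq_eq_false_iff_ne, List.any_eq_false,
    List.mem_finRange, true_imp_iff]
  refine ⟨⟨hxy, ?_⟩, ?_⟩
  · rw [← Bool.not_eq_true, ← hE.adj]
    exact fun hh => hP.tri _ _ _ hx hh hy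
  · intro z hz
    have h1 := (hE.adj x z).2 hz.1
    have h2 := (hE.adj y z).2 hz.2
    exact hP.quad (h x) u (h y) (h z) (fun hh => hxy (hE.inj _ _ hh)) (hu z) hx.symm hy h2 h1.symm

/-- All nonadjacent pairs pass the parity test. -/
def allchk {k : ℕ} (M : Fin k → Fin k → Bool) : Bool :=
  (List.finRange k).all fun x => (List.finRange k).all fun y =>
    (x == y) || M x y || chk M (fun z => z == x || z == y || (M z x && M z y)) x y

/-- `f` is a colouring. -/
def colchk {k : ℕ} (M : Fin k → Fin k → Bool) (f : Fin k → Fin 3) : Bool :=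
  (List.finRange k).all fun x => (List.finRange k).all fun y => !(M x y) || !(f x == f y)

theorem colchk_spec {k : ℕ} {M : Fin k → Fin k → Bool} {f : Fin k → Fin 3}
    (hc : colchk M f = true) : ∃ f : Fin k → Fin 3, ∀ i j, M i j = true → f i ≠ f j := by
  refine ⟨f, ?_⟩
  intro i j hij hf
  unfold colchk at hc
  simp only [List.all_eq_true, List.mem_finRange, true_imp_iff] at hc
  have := hc i j
  simp [hij, hf] at this

theorem templ_two (hP : Pent G) {k : ℕ} {M : Fin k → Fin k → Bool} {h : Fin k → V}
    (hE : Emb G M h) {f : Fin k → Fin 3} (hcol : colchk M f = true)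
    {x₀ y₀ : Fin k} (h₀ : x₀ ≠ y₀) (h₁ : M x₀ y₀ = false) (hall : allchk M = true) :
    ∃ x y u, x ≠ y ∧ (∀ z, u ≠ h z) ∧ G.Adj u (h x) ∧ G.Adj u (h y) := by
  obtain ⟨n, x, y, p, hg, hatt⟩ := templ hP hE (colchk_spec hcol) h₀ h₁
  rcases Nat.lt_or_ge 2 n with h3 | h3
  · exfalso
    unfold allchk at hall
    simp only [List.all_eq_true, List.mem_finRange, true_imp_iff, Bool.or_eq_true, beq_iff_eq]
      at hall
    have hc := ((hall x y).resolve_left (by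
      rw [hg.nadj]
      rintro (hh | hh)
      · exact hg.ne hh
      · exact Bool.noConfusion hh))
    refine path_K hP hE hc hg.ip hg.p0 hg.pn h3 hg.out ?_
    intro i hi hin z hz
    rcases hatt h3 i hi hin z hz with hh | hh | hh
    · simp [hh]
    · simp [hh]
    · simp [hh]
  · have h2 : n = 2 := le_antisymm h3 hg.two
    subst h2
    refine ⟨x, y, p 1, hg.ne, hg.out 1 (by omega) (by omega), ?_, ?_⟩
    · rw [← hg.p0]
      exact ((hg.ip 0 1 (by omega) (by omega)).2.2 rfl).symm
    · rw [← hg.pn]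
      exact (hg.ip 1 2 (by omega) (by omega)).2.2 rfl

/-- Every far pair gives a 7-hole. -/
def far7 {k : ℕ} (M : Fin k → Fin k → Bool) : Bool :=
  (List.finRange k).all fun x => (List.finRange k).all fun y =>
    !(far M x y) || hasPath M (fun z => far M z x && far M z y) x y 5

theorem no_templ (hP : Pent G) {k : ℕ} {M : Fin k → Fin k → Bool} {h : Fin k → V}
    (hE : Emb G M h) {f : Fin k → Fin 3} (hcol : colchk M f = true)
    {x₀ y₀ : Fin k} (h₀ : x₀ ≠ y₀) (h₁ : M x₀ y₀ = false) (hall : allchk M = true)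
    (h7 : far7 M = true) : False := by
  obtain ⟨x, y, u, hxy, hu, hx, hy⟩ := templ_two hP hE hcol h₀ h₁ hall
  have hf := far_of hP hE hu hxy hx hy
  unfold far7 at h7
  simp only [List.all_eq_true, List.mem_finRange, true_imp_iff] at h7
  have hh := h7 x y
  rw [hf] at hh
  simp only [Bool.not_true, Bool.false_or] at hh
  obtain ⟨p, hp, hp0, hp5, hpT⟩ := hasPath_spec hE hh
  have hnM : ¬ G.Adj (h x) (h y) := fun hh => hP.tri _ _ _ hx hh hy
  refine two_paths hP (n := 2) (m := 5)
    (p := fun j => if j = 0 then h x else if j = 1 then u else h y) ?_ hp ?_ ?_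
    (by omega) (by omega) ?_ (by decide) (by omega)
  · intro a b hab hb
    have : (a = 0 ∧ b = 1) ∨ (a = 0 ∧ b = 2) ∨ (a = 1 ∧ b = 2) := by omega
    rcases this with ⟨rfl, rfl⟩ | ⟨rfl, rfl⟩ | ⟨rfl, rfl⟩
    · simp [hx.symm, (hu x).symm]
    · simp only [if_true, OfNat.ofNat_ne_zero, if_false, OfNat.ofNat_ne_one]
      exact ⟨fun hh => hxy (hE.inj _ _ hh), by simp [hnM]⟩
    · simp [hy, hu y]
  · simp [hp0]
  · simp [hp5]
  · intro i j hi hi2 hj hj5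
    have : i = 1 := by omega
    subst this
    simp only [one_ne_zero, if_false, if_true]
    refine ⟨hu _, fun hadj => ?_⟩
    have hT := hpT j hj hj5
    have hjx : p j ≠ x := by
      rw [← hp0]
      intro hc
      exact (hp 0 j hj hj5.le).1 (by simp only; rw [hc])
    have hjy : p j ≠ y := by
      rw [← hp5]
      intro hc
      exact (hp j 5 hj5 le_rfl).1 (by simp only; rw [hc])
    rw [far_of hP hE hu hjx hadj hx, far_of hP hE hu hjy hadj hy] at hT
    exact Bool.noConfusion hT

/-- Add a new last vertex with neighbourhood `s`. -/
def extM {k : ℕ} (M : Fin k → Fin k → Bool) (s : Fin k → Bool) (i j : Fin (k+1)) : Bool :=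
  if hi : i.val < k then
    if hj : j.val < k then M ⟨i.val, hi⟩ ⟨j.val, hj⟩ else s ⟨i.val, hi⟩
  else if hj : j.val < k then s ⟨j.val, hj⟩ else false

theorem ext_emb {k : ℕ} {M : Fin k → Fin k → Bool} {h : Fin k → V} (hE : Emb G M h)
    {u : V} (hu : ∀ z, u ≠ h z) {s : Fin k → Bool} (hs : ∀ i, G.Adj u (h i) ↔ s i = true) :
    Emb G (extM M s) (fun i => if hi : i.val < k then h ⟨i.val, hi⟩ else u) := by
  constructor
  · intro i j hij
    by_cases hi : i.val < k
    · by_cases hj : j.val < k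
      · simp only [hi, hj, dif_pos] at hij
        have := hE.inj _ _ hij
        simp only [Fin.mk.injEq] at this
        exact Fin.ext this
      · simp only [hi, hj, dif_pos, dif_neg, not_false_eq_true] at hij
        exact absurd hij.symm (hu _)
    · by_cases hj : j.val < k
      · simp only [hi, hj, dif_pos, dif_neg, not_false_eq_true] at hij
        exact absurd hij (hu _)
      · exact Fin.ext (by omega)
  · intro i j
    unfold extM
    by_cases hi : i.val < k
    · by_cases hj : j.val < k
      · simp only [hi, hj, dif_pos]
        exact hE.adj _ _
      · simp only [hi, hj, dif_pos, dif_neg, not_false_eq_true]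
        rw [G.adj_comm]; exact hs _
    · by_cases hj : j.val < k
      · simp only [hi, hj, dif_pos, dif_neg, not_false_eq_true]
        exact hs _
      · simp [hi, hj]

/-- The table of `θ⁺`. -/
def MH (i j : Fin 8) : Bool :=
  (i.val + 1) % 8 == j.val || (j.val + 1) % 8 == i.val || ((i.val + 4) % 8 == j.val && i.val % 2 == 0)

/-- Petersen minus a vertex. -/
def MP : Fin 9 → Fin 9 → Bool := extM MH (fun i => i == 1 || i == 5)

/-- Ten-vertex templates. -/
def MT (a b c : Bool) : Fin 10 → Fin 10 → Bool :=
  extM MP (fun i => (i == 3 && a) || (i == 7 && b) || (i == 8 && c))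

/-- A colouring of the Petersen graph. -/
def pcol (i : ℕ) : Fin 3 := [0, 1, 0, 2, 1, 2, 1, 2, 0, 1].getD i 0

end Templates

/-! ### The nine- and ten-vertex templates do not occur -/

section Small

variable {V : Type*} {G : SimpleGraph V}

theorem MP_all : allchk MP = true := by decide +kernel

theorem MP_col : colchk MP (fun i => pcol i.val) = true := by decide +kernel

theorem MT_all : ∀ a b c : Bool, (a && b || a && c || b && c) = true →
    allchk (MT a b c) = true ∧ far7 (MT a b c) = true ∧
      colchk (MT a b c) (fun i => pcol i.val) = true ∧ MT a b c 0 2 = false := by decide +kernel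

theorem MP_far : ∀ x y : Fin 9, far MP x y = true → (x = 3 ∨ x = 7 ∨ x = 8) := by decide +kernel

theorem MH_far : ∀ x y : Fin 8, far MH x y = true →
    (x = 1 ∧ y = 5) ∨ (x = 5 ∧ y = 1) ∨ (x = 3 ∧ y = 7) ∨ (x = 7 ∧ y = 3) := by decide +kernel

theorem MH_rot : ∀ i j : Fin 8, MH (i + 2) (j + 2) = MH i j := by decide +kernel

theorem no_MT (hP : Pent G) {a b c : Bool} (habc : (a && b || a && c || b && c) = true)
    {h : Fin 10 → V} (hE : Emb G (MT a b c) h) : False := by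
  obtain ⟨h1, h2, h3, h4⟩ := MT_all a b c habc
  exact no_templ hP hE h3 (x₀ := 0) (y₀ := 2) (by decide) h4 h1 h2

theorem no_MP (hP : Pent G) {h : Fin 9 → V} (hE : Emb G MP h) : False := by
  classical
  obtain ⟨x, y, u, hxy, hu, hx, hy⟩ := templ_two hP hE MP_col (x₀ := 0) (y₀ := 2) (by decide)
    (by decide +kernel) MP_all
  have hx' := MP_far x y (far_of hP hE hu hxy hx hy)
  have hy' := MP_far y x (far_of hP hE hu hxy.symm hy hx)
  have hall : ∀ i, G.Adj u (h i) → (i = 3 ∨ i = 7 ∨ i = 8) := by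
    intro i hi
    by_cases hix : i = x
    · rw [hix]; exact hx'
    · exact MP_far i x (far_of hP hE hu hix hi hx)
  refine no_MT hP (a := decide (G.Adj u (h 3))) (b := decide (G.Adj u (h 7)))
    (c := decide (G.Adj u (h 8))) ?_ (ext_emb hE hu ?_)
  · rcases hx' with rfl | rfl | rfl <;> rcases hy' with rfl | rfl | rfl <;> simp_all
  · intro i
    constructor
    · intro hi
      rcases hall i hi with rfl | rfl | rfl <;> simp [hi]
    · intro hi
      simp only [Bool.or_eq_true, Bool.and_eq_true, beq_iff_eq, decide_eq_true_eq] at hi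
      rcases hi with (⟨rfl, hi⟩ | ⟨rfl, hi⟩) | ⟨rfl, hi⟩ <;> exact hi

theorem emb_rot {h : Fin 8 → V} {e : Fin 8 → Fin 8} (hE : Emb G MH h)
    (he : ∀ i j, MH (e i) (e j) = MH i j) (he' : ∀ i j, e i = e j → i = j) :
    Emb G MH (fun i => h (e i)) :=
  ⟨fun i j hij => he' _ _ (hE.inj _ _ hij), fun i j => by rw [hE.adj, he]⟩

theorem no_15 (hP : Pent G) {h : Fin 8 → V} (hE : Emb G MH h) {u : V} (hu : ∀ z, u ≠ h z)
    (h1 : G.Adj u (h 1)) (h5 : G.Adj u (h 5)) : False := by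
  refine no_MP hP (ext_emb hE hu (s := fun i => i == 1 || i == 5) ?_)
  intro i
  constructor
  · intro hi
    by_cases hi1 : i = 1
    · simp [hi1]
    · have := MH_far i 1 (far_of hP hE hu hi1 hi h1)
      rcases this with hh | hh | hh | hh
      · exact absurd hh.1 hi1
      · simp [hh.1]
      · exact absurd hh.2 (by decide)
      · exact absurd hh.2 (by decide)
  · intro hi
    simp only [Bool.or_eq_true, beq_iff_eq] at hi
    rcases hi with rfl | rfl
    · exact h1
    · exact h5

theorem no_37 (hP : Pent G) {h : Fin 8 → V} (hE : Emb G MH h) {u : V} (hu : ∀ z, u ≠ h z)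
    (h3 : G.Adj u (h 3)) (h7 : G.Adj u (h 7)) : False :=
  no_15 hP (emb_rot hE MH_rot (fun i j hij => by simpa using hij)) (fun z => hu _) h3 h7

theorem att_one (hP : Pent G) {h : Fin 8 → V} (hE : Emb G MH h) {u : V} (hu : ∀ z, u ≠ h z)
    {i j : Fin 8} (hi : G.Adj u (h i)) (hj : G.Adj u (h j)) : i = j := by
  by_contra hij
  rcases MH_far i j (far_of hP hE hu hij hi hj) with ⟨rfl, rfl⟩ | ⟨rfl, rfl⟩ | ⟨rfl, rfl⟩ | ⟨rfl, rfl⟩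
  · exact no_15 hP hE hu hi hj
  · exact no_15 hP hE hu hj hi
  · exact no_37 hP hE hu hi hj
  · exact no_37 hP hE hu hj hi

end Small

/-! ### The main argument -/

section Main

variable {V : Type*} {G : SimpleGraph V}

/-- A connected set outside the template, all of whose attachments are in `L`. -/
structure Piece (G : SimpleGraph V) (h : Fin 8 → V) (F : Set V) (L : List (Fin 8)) : Prop where
  conn : Conn G F
  out : ∀ u ∈ F, ∀ z, u ≠ h z
  att : ∀ u ∈ F, ∀ z, G.Adj u (h z) → z ∈ L

/-- `F` is attached to the vertex `z` of the template. -/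
def Att (G : SimpleGraph V) (h : Fin 8 → V) (F : Set V) (z : Fin 8) : Prop :=
  ∃ u ∈ F, G.Adj u (h z)

theorem Att.mono {h : Fin 8 → V} {F F' : Set V} {z : Fin 8} (ha : Att G h F z) (hF : F ⊆ F') :
    Att G h F' z := by
  obtain ⟨u, hu, hz⟩ := ha
  exact ⟨u, hF hu, hz⟩

theorem Piece.insert {h : Fin 8 → V} {F : Set V} {L L' : List (Fin 8)} (hF : Piece G h F L)
    {u v : V} (hv : v ∈ F) (hvu : G.Adj v u) (hu : ∀ z, u ≠ h z) (hL : ∀ z ∈ L, z ∈ L')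
    (hatt : ∀ z, G.Adj u (h z) → z ∈ L') : Piece G h (Insert.insert u F) L' := by
  refine ⟨conn_insert hF.conn hv hvu, ?_, ?_⟩
  · rintro w (rfl | hw)
    · exact hu
    · exact hF.out w hw
  · rintro w (rfl | hw)
    · exact hatt
    · exact fun z hz => hL z (hF.att w hw z hz)

theorem piece_path (hP : Pent G) {h : Fin 8 → V} (hE : Emb G MH h) {F : Set V} {L : List (Fin 8)}
    (hF : Piece G h F L) {x y : Fin 8} (hx : Att G h F x) (hy : Att G h F y) (hxy : x ≠ y)
    (hM : MH x y = false) : ∃ n p, 3 ≤ n ∧ IP G n p ∧ p 0 = h x ∧ p n = h y ∧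
      ∀ k, 0 < k → k < n → p k ∈ F := by
  obtain ⟨u, hu, hux⟩ := hx
  obtain ⟨v, hv, hvy⟩ := hy
  obtain ⟨n, p, hn, hp, hp0, hpn, hpF⟩ := path_through hF.conn
    (fun hh => hxy (hE.inj _ _ hh)) (hE.nadj hM) hu hv hux.symm hvy
  refine ⟨n, p, ?_, hp, hp0, hpn, hpF⟩
  by_contra hlt
  have h2 : n = 2 := by omega
  subst h2
  have h1 := (hp 0 1 (by omega) (by omega)).2.2 rfl
  have h2 := (hp 1 2 (by omega) (by omega)).2.2 rfl
  rw [hp0] at h1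
  rw [hpn] at h2
  exact hxy (att_one hP hE (hF.out _ (hpF 1 (by omega) (by omega))) h1.symm h2)

theorem piece_K (hP : Pent G) {h : Fin 8 → V} (hE : Emb G MH h) {F : Set V} {L : List (Fin 8)}
    (hF : Piece G h F L) {x y : Fin 8} (hx : Att G h F x) (hy : Att G h F y) (hxy : x ≠ y)
    (hM : MH x y = false) (hchk : chk MH (fun z => decide (z ∈ L)) x y = true) : False := by
  obtain ⟨n, p, hn, hp, hp0, hpn, hpF⟩ := piece_path hP hE hF hx hy hxy hM
  refine path_K hP hE hchk hp hp0 hpn hn (fun i hi hin => hF.out _ (hpF i hi hin)) ?_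
  intro i hi hin z hz
  simpa using hF.att _ (hpF i hi hin) z hz

theorem claim_C' (hP : Pent G) {h : Fin 8 → V} (hE : Emb G MH h) {F : Set V}
    (hF : Piece G h F [1, 3]) (h1 : Att G h F 1) (h3 : Att G h F 3) :
    ∃ p ∈ F, ∃ q ∈ F, G.Adj p (h 1) ∧ G.Adj q (h 3) ∧ G.Adj p q := by
  obtain ⟨n, p, hn, hp, hp0, hpn, hpF⟩ := piece_path hP hE hF h1 h3 (by decide) (by decide +kernel)
  have key : ∀ m, 2 ≤ m → Odd (n + m) → 7 ≤ n + m →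
      hasPath MH (fun z => decide (z ∈ [(1 : Fin 8), 3])) 1 3 m = true → False := by
    intro m hm hodd h7 hh
    obtain ⟨q, hq, hq0, hqm, hqT⟩ := hasPath_spec hE hh
    refine two_paths hP hp hq (by rw [hp0, hq0]) (by rw [hpn, hqm]) (by omega) hm ?_ hodd h7
    intro i j hi hin hj hjm
    refine ⟨hF.out _ (hpF i hi hin) _, fun hadj => ?_⟩
    have h1 := hF.att _ (hpF i hi hin) _ hadj
    have h2 := hqT j hj hjm
    exact (of_decide_eq_false h2) h1
  have hn3 : n = 3 := by
    by_contra hne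
    rcases Nat.even_or_odd n with he | ho
    · exact key 3 (by omega) (he.add_odd (by decide)) (by omega) (by decide +kernel)
    · have ho' := ho
      obtain ⟨t, ht⟩ := ho'
      exact key 2 (by omega) (ho.add_even (by decide)) (by omega) (by decide +kernel)
  subst hn3
  refine ⟨p 1, hpF 1 (by omega) (by omega), p 2, hpF 2 (by omega) (by omega), ?_, ?_, ?_⟩
  · rw [← hp0]; exact ((hp 0 1 (by omega) (by omega)).2.2 rfl).symm
  · rw [← hpn]; exact (hp 2 3 (by omega) (by omega)).2.2 rfl
  · exact (hp 1 2 (by omega) (by omega)).2.2 rfl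

theorem claim_C (hP : Pent G) {h : Fin 8 → V} (hE : Emb G MH h) {F : Set V}
    (hF : Piece G h F [0, 1, 3]) (h0 : Att G h F 0) (h3 : Att G h F 3) :
    ∃ p ∈ F, ∃ q ∈ F, G.Adj p (h 1) ∧ G.Adj q (h 3) ∧ G.Adj p q := by
  obtain ⟨r, hr, hr0⟩ := h0
  obtain ⟨b, hb, hb3⟩ := h3
  set S : Set V := {v | ¬ G.Adj v (h 0)} with hS
  have hbS : b ∈ S := fun hh => absurd (att_one hP hE (hF.out b hb) hh hb3) (by decide)
  set F0 := comp G (F ∩ S) b with hF0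
  have hsub : F0 ⊆ F ∩ S := comp_sub ⟨hb, hbS⟩
  have hrF : r ∉ F0 := fun hh => (hsub hh).2 hr0
  have hatt : ∀ u ∈ F0, ∀ z, G.Adj u (h z) → z = 1 ∨ z = 3 := by
    intro u hu z hz
    have := hF.att u (hsub hu).1 z hz
    simp only [List.mem_cons, List.not_mem_nil, or_false] at this
    rcases this with rfl | rfl | rfl
    · exact absurd hz (hsub hu).2
    · simp
    · simp
  have hp3 : Att G h F0 3 := ⟨b, comp_self, hb3⟩
  by_cases h1 : Att G h F0 1
  · have hp : Piece G h F0 [1, 3] := ⟨comp_conn, fun u hu => hF.out u (hsub hu).1,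
      fun u hu z hz => by simpa using hatt u hu z hz⟩
    obtain ⟨p, hp, q, hq, hh⟩ := claim_C' hP hE hp h1 hp3
    exact ⟨p, (hsub hp).1, q, (hsub hq).1, hh⟩
  · exfalso
    obtain ⟨c, hc, d, hd, hdS, hcd⟩ := comp_boundary hF.conn hb hbS hr hrF
    have hd0 : G.Adj d (h 0) := by
      by_contra hh; exact hdS hh
    have hp : Piece G h F0 [3] := ⟨comp_conn, fun u hu => hF.out u (hsub hu).1, by
      intro u hu z hz
      rcases hatt u hu z hz with rfl | rfl
      · exact absurd ⟨u, hu, hz⟩ h1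
      · simp⟩
    have hp' : Piece G h (insert d F0) [0, 3] := hp.insert hc hcd (hF.out d hd) (by simp)
      (fun z hz => by simp [att_one hP hE (hF.out d hd) hz hd0])
    exact piece_K hP hE hp' (x := 0) (y := 3) ⟨d, by simp, hd0⟩ (hp3.mono (Set.subset_insert _ _))
      (by decide) (by decide +kernel) (by decide +kernel)

/-- Growing a connected set until it is cut off by `X` or touches `W`. -/
theorem ext_lemma {F X W : Set V} {a : V} (ha : a ∈ F) (hF : Conn G F)
    (hX : ∀ v ∈ F, v ∉ X) (hW : ∀ v ∈ F, v ∉ W) (hFW : ∀ v ∈ F, ∀ w ∈ W, ¬ G.Adj v w) :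
    ∃ A, F ⊆ A ∧ Conn G A ∧ (∀ v ∈ A, v ∉ X) ∧ (∀ v ∈ A, v ∉ W) ∧
      (∀ v ∈ A, ∀ w ∈ W, ¬ G.Adj v w) ∧
      ((∀ v ∈ A, ∀ y, y ∉ A → G.Adj v y → y ∈ X) ∨
        ∃ u, u ∉ X ∧ u ∉ W ∧ (∃ v ∈ A, G.Adj v u) ∧ ∃ w ∈ W, G.Adj u w) := by
  set C : Set V := {v | v ∉ X ∧ v ∉ W ∧ ∀ w ∈ W, ¬ G.Adj v w} with hC
  have hFC : F ⊆ C := fun v hv => ⟨hX v hv, hW v hv, hFW v hv⟩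
  have haC := hFC ha
  have hAC : comp G C a ⊆ C := comp_sub haC
  refine ⟨comp G C a, fun v hv => (hF a ha v hv).mono hFC, comp_conn, fun v hv => (hAC hv).1,
    fun v hv => (hAC hv).2.1, fun v hv => (hAC hv).2.2, ?_⟩
  by_cases hh : ∀ v ∈ comp G C a, ∀ y, y ∉ comp G C a → G.Adj v y → y ∈ X
  · exact Or.inl hh
  · right
    push Not at hh
    obtain ⟨v, hv, y, hy, hvy, hyX⟩ := hh
    have hyW : y ∉ W := fun hyW => (hAC hv).2.2 y hyW hvy
    refine ⟨y, hyX, hyW, ⟨v, hv, hvy⟩, ?_⟩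
    by_contra hno
    push Not at hno
    exact hy (comp_closed haC hv ⟨hyX, hyW, hno⟩ hvy)

/-- A path of length four in a graph without short cycles. -/
theorem ip4 (hP : Pent G) {a b c d e : V} (hab : G.Adj a b) (hbc : G.Adj b c) (hcd : G.Adj c d)
    (hde : G.Adj d e) (hac : a ≠ c) (hbd : b ≠ d) (hce : c ≠ e) (hae : a ≠ e)
    (hnae : ¬ G.Adj a e) :
    ∃ r : ℕ → V, IP G 4 r ∧ r 0 = a ∧ r 4 = e ∧ r 1 = b ∧ r 2 = c ∧ r 3 = d := by
  have nac : ¬ G.Adj a c := fun hh => hP.tri _ _ _ hab hbc hh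
  have nbd : ¬ G.Adj b d := fun hh => hP.tri _ _ _ hbc hcd hh
  have nce : ¬ G.Adj c e := fun hh => hP.tri _ _ _ hcd hde hh
  have had : a ≠ d := fun hh => nac (hh ▸ hcd.symm)
  have hbe : b ≠ e := fun hh => nbd (hh ▸ hde.symm)
  have nad : ¬ G.Adj a d := fun hh => hP.quad a b c d hac hbd hab hbc hcd hh.symm
  have nbe : ¬ G.Adj b e := fun hh => hP.quad b c d e hbd hce hbc hcd hde hh.symm
  refine ⟨fun i => if i = 0 then a else if i = 1 then b else if i = 2 then c else
    if i = 3 then d else e, ?_, by simp, by simp, by simp, by simp, by simp⟩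
  intro i j hij hj
  have : j = 1 ∨ j = 2 ∨ j = 3 ∨ j = 4 := by omega
  rcases this with rfl | rfl | rfl | rfl
  · have : i = 0 := by omega
    subst this
    simp [hab, hab.ne]
  · have : i = 0 ∨ i = 1 := by omega
    rcases this with rfl | rfl
    · simp [nac, hac]
    · simp [hbc, hbc.ne]
  · have : i = 0 ∨ i = 1 ∨ i = 2 := by omega
    rcases this with rfl | rfl | rfl
    · simp [nad, had]
    · simp [nbd, hbd]
    · simp [hcd, hcd.ne]
  · have : i = 0 ∨ i = 1 ∨ i = 2 ∨ i = 3 := by omega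
    rcases this with rfl | rfl | rfl | rfl
    · simp [hnae, hae]
    · simp [nbe, hbe]
    · simp [nce, hce]
    · simp [hde, hde.ne]

/-- Middle vertices next to `h 1` of paths of length three from `h 1` to `h 3`. -/
def Pst (G : SimpleGraph V) (h : Fin 8 → V) : Set V :=
  {p | (∀ z, p ≠ h z) ∧ G.Adj p (h 1) ∧ ∃ q, (∀ z, q ≠ h z) ∧ G.Adj q (h 3) ∧ G.Adj p q}

/-- Middle vertices next to `h 3` of paths of length three from `h 1` to `h 3`. -/
def Qst (G : SimpleGraph V) (h : Fin 8 → V) : Set V :=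
  {q | (∀ z, q ≠ h z) ∧ G.Adj q (h 3) ∧ ∃ p, (∀ z, p ≠ h z) ∧ G.Adj p (h 1) ∧ G.Adj p q}

theorem obs1 (hP : Pent G) {h : Fin 8 → V} (hE : Emb G MH h) {F : Set V}
    (hF : Piece G h F [0, 1, 3]) (h0 : Att G h F 0) (hd : ∀ v ∈ F, v ∉ Pst G h) :
    ¬ Att G h F 3 := by
  intro h3
  obtain ⟨p, hp, q, hq, hp1, hq3, hpq⟩ := claim_C hP hE hF h0 h3
  exact hd p hp ⟨hF.out p hp, hp1, q, hF.out q hq, hq3, hpq⟩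

theorem obs2 (hP : Pent G) {h : Fin 8 → V} (hE : Emb G MH h) {F : Set V}
    (hF : Piece G h F [0, 1]) (h0 : Att G h F 0) (hd : ∀ v ∈ F, v ∉ Pst G h) :
    ∀ u ∈ F, ∀ q ∈ Qst G h, ¬ G.Adj u q := by
  intro u hu q hq huq
  have hp : Piece G h (insert q F) [0, 1, 3] := hF.insert hu huq hq.1 (by simp)
    (fun z hz => by simp [att_one hP hE hq.1 hz hq.2.1])
  refine obs1 hP hE hp (h0.mono (Set.subset_insert _ _)) ?_ ⟨q, by simp, hq.2.1⟩
  rintro v (rfl | hv) hvP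
  · exact absurd (att_one hP hE hq.1 hq.2.1 hvP.2.1) (by decide)
  · exact hd v hv hvP

theorem step3_cut (hP : Pent G) {h : Fin 8 → V} (hE : Emb G MH h) {A : Set V} (hA : Conn G A)
    (hne : A.Nonempty)
    (hX : ∀ v ∈ A, v ∉ ({h 0, h 1} ∪ Pst G h : Set V))
    (hW : ∀ v ∈ A, v ∉ ({h 2, h 3, h 4, h 5, h 6, h 7} ∪ Qst G h : Set V))
    (hN : ∀ v ∈ A, ∀ y, y ∉ A → G.Adj v y → y ∈ ({h 0, h 1} ∪ Pst G h : Set V)) : False := by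
  have h3X : h 3 ∉ ({h 0, h 1} ∪ Pst G h : Set V) := by
    rintro ((hh | hh) | hh)
    · exact absurd (hE.inj _ _ hh) (by decide)
    · exact absurd (hE.inj _ _ hh) (by decide)
    · exact hh.1 3 rfl
  have h4X : h 4 ∉ ({h 0, h 1} ∪ Pst G h : Set V) := by
    rintro ((hh | hh) | hh)
    · exact absurd (hE.inj _ _ hh) (by decide)
    · exact absurd (hE.inj _ _ hh) (by decide)
    · exact hh.1 4 rfl
  have hQX : ∀ q ∈ Qst G h, q ∉ ({h 0, h 1} ∪ Pst G h : Set V) := by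
    rintro q hq ((hh | hh) | hh)
    · exact hq.1 _ hh
    · exact hq.1 _ hh
    · exact absurd (att_one hP hE hq.1 hq.2.1 hh.2.1) (by decide)
  have good : ∀ v, v ∈ ({h 2, h 3, h 4, h 5, h 6, h 7} ∪ Qst G h : Set V) →
      v ∉ ({h 0, h 1} ∪ Pst G h : Set V) → v ∉ A ∧ v ≠ h 1 ∧ ∀ a ∈ A, ¬ G.Adj a v := by
    intro v hv hvX
    have hvA : v ∉ A := fun hh => hW v hh hv
    exact ⟨hvA, fun hh => hvX (by simp [hh]), fun a ha hav => hvX (hN a ha v hvA hav)⟩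
  have g3 := good (h 3) (by simp) h3X
  have g4 := good (h 4) (by simp) h4X
  have h1A : h 1 ∉ A := fun hh => hX _ hh (by simp)
  have ht : ∀ i j, MH i j = true → G.Adj (h i) (h j) := fun i j hh => (hE.adj i j).2 hh
  -- the basic path from `h 0` to a vertex of `Pst`
  have base : ∀ p ∈ Pst G h, ∃ r : ℕ → V, IP G 4 r ∧ r 0 = h 0 ∧ r 4 = p ∧
      ∀ k, 0 < k → k < 4 → r k ∉ A ∧ r k ≠ h 1 ∧ ∀ a ∈ A, ¬ G.Adj a (r k) := by
    rintro p ⟨hp, hp1, q, hq, hq3, hpq⟩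
    have hqQ : q ∈ Qst G h := ⟨hq, hq3, p, hp, hp1, hpq⟩
    obtain ⟨r, hr, r0, r4, r1, r2, r3⟩ := ip4 hP (ht 0 4 (by decide +kernel))
      (ht 4 3 (by decide +kernel)) hq3.symm hpq.symm
      (fun hh => absurd (hE.inj _ _ hh) (by decide)) (hq 4).symm (hp 3).symm (hp 0).symm
      (fun hh => absurd (att_one hP hE hp hh.symm hp1) (by decide))
    refine ⟨r, hr, r0, r4, ?_⟩
    intro k hk hk4
    have : k = 1 ∨ k = 2 ∨ k = 3 := by omega
    rcases this with rfl | rfl | rfl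
    · rw [r1]; exact g4
    · rw [r2]; exact g3
    · rw [r3]; exact good q (Or.inr hqQ) (hQX q hqQ)
  refine star_cut hP (A := A) (c := h 1) (fun _ => true) hA hne h1A ?_ ⟨h 3, g3⟩ ?_
  · intro a ha y hy hay
    rcases hN a ha y hy hay with (rfl | rfl) | hh
    · exact Or.inr (ht 1 0 (by decide +kernel))
    · exact Or.inl rfl
    · exact Or.inr hh.2.1.symm
  · rintro y y' hy hy' hyy hcy hcy' ⟨a, ha, hay⟩ ⟨a', ha', hay'⟩
    have k1 := hN a ha y hy hay
    have k2 := hN a' ha' y' hy' hay'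
    have k1' : y = h 0 ∨ y ∈ Pst G h := by
      rcases k1 with (hh | hh) | hh
      · exact Or.inl hh
      · exact absurd hh hcy.ne'
      · exact Or.inr hh
    have k2' : y' = h 0 ∨ y' ∈ Pst G h := by
      rcases k2 with (hh | hh) | hh
      · exact Or.inl hh
      · exact absurd hh hcy'.ne'
      · exact Or.inr hh
    rcases k1' with rfl | k1'
    · rcases k2' with rfl | k2'
      · exact absurd rfl hyy
      · obtain ⟨r, hr, r0, r4, hinter⟩ := base y' k2'
        exact ⟨4, r, hr, r0, r4, hinter, by decide⟩
    · rcases k2' with rfl | k2'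
      · obtain ⟨r, hr, r0, r4, hinter⟩ := base y k1'
        exact ⟨4, fun i => r (4 - i), hr.rev, r4, r0,
          fun k hk hk4 => hinter (4 - k) (by omega) (by omega), by decide⟩
      · obtain ⟨hp, hp1, q, hq, hq3, hpq⟩ := k1'
        obtain ⟨hp', hp1', q', hq', hq3', hpq'⟩ := k2'
        have hqQ : q ∈ Qst G h := ⟨hq, hq3, y, hp, hp1, hpq⟩
        have hqQ' : q' ∈ Qst G h := ⟨hq', hq3', y', hp', hp1', hpq'⟩
        have hqq : q ≠ q' := by
          rintro rfl
          exact hP.quad y q y' (h 1) hyy (hq 1) hpq hpq'.symm hcy'.symm hcy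
        obtain ⟨r, hr, r0, r4, r1, r2, r3⟩ := ip4 hP hpq hq3 hq3'.symm hpq'.symm (hp 3) hqq
          (hp' 3).symm hyy (fun hh => hP.tri _ _ _ hcy hh hcy')
        refine ⟨4, r, hr, r0, r4, ?_, by decide⟩
        intro k hk hk4
        have : k = 1 ∨ k = 2 ∨ k = 3 := by omega
        rcases this with rfl | rfl | rfl
        · rw [r1]; exact good q (Or.inr hqQ) (hQX q hqQ)
        · rw [r2]; exact g3
        · rw [r3]; exact good q' (Or.inr hqQ') (hQX q' hqQ')

theorem step3 (hP : Pent G) {h : Fin 8 → V} (hE : Emb G MH h) {F : Set V}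
    (hF : Piece G h F [0, 1, 3]) (h0 : Att G h F 0) (h3 : Att G h F 3) : False := by
  obtain ⟨p₀, hp₀, q₀, hq₀, hp₀1, hq₀3, hpq₀⟩ := claim_C hP hE hF h0 h3
  have hp₀P : p₀ ∈ Pst G h := ⟨hF.out _ hp₀, hp₀1, q₀, hF.out _ hq₀, hq₀3, hpq₀⟩
  obtain ⟨r, hr, hr0⟩ := h0
  have hrP : r ∈ (Pst G h)ᶜ := fun hh =>
    absurd (att_one hP hE (hF.out r hr) hr0 hh.2.1) (by decide)
  set R := comp G (F ∩ (Pst G h)ᶜ) r with hR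
  have hRF : R ⊆ F ∩ (Pst G h)ᶜ := comp_sub ⟨hr, hrP⟩
  obtain ⟨c, hc, p, hpF, hpP, hcp⟩ := comp_boundary hF.conn hr hrP hp₀ (fun hh => (hRF hh).2 hp₀P)
  have hpP : p ∈ Pst G h := by
    by_contra hh; exact hpP hh
  clear hpF p₀ hp₀ q₀ hq₀ hp₀1 hq₀3 hpq₀ hp₀P
  have hR013 : Piece G h R [0, 1, 3] := ⟨comp_conn, fun u hu => hF.out u (hRF hu).1,
    fun u hu => hF.att u (hRF hu).1⟩
  have hRatt0 : Att G h R 0 := ⟨r, comp_self, hr0⟩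
  have hR3 := obs1 hP hE hR013 hRatt0 (fun v hv => (hRF hv).2)
  have hR01 : Piece G h R [0, 1] := ⟨comp_conn, fun u hu => hF.out u (hRF hu).1, by
    intro u hu z hz
    have := hR013.att u hu z hz
    simp only [List.mem_cons, List.not_mem_nil, or_false] at this ⊢
    rcases this with hh | hh | hh
    · exact Or.inl hh
    · exact Or.inr hh
    · subst hh; exact absurd ⟨u, hu, hz⟩ hR3⟩
  have hRQ := obs2 hP hE hR01 hRatt0 (fun v hv => (hRF hv).2)
  obtain ⟨A, hRA, hA, hAX, hAW, hANW, halt⟩ := ext_lemma (G := G) (F := R)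
    (X := {h 0, h 1} ∪ Pst G h) (W := {h 2, h 3, h 4, h 5, h 6, h 7} ∪ Qst G h) (a := r) comp_self
    comp_conn (by
      rintro v hv ((hh | hh) | hh)
      · exact hR01.out v hv _ hh
      · exact hR01.out v hv _ hh
      · exact (hRF hv).2 hh) (by
      rintro v hv (hh | hh)
      · simp only [Set.mem_insert_iff, Set.mem_singleton_iff] at hh
        rcases hh with hh | hh | hh | hh | hh | hh <;> exact hR01.out v hv _ hh
      · exact hR3 ⟨v, hv, hh.2.1⟩) (by
      rintro v hv w (hh | hh) hvw
      · simp only [Set.mem_insert_iff, Set.mem_singleton_iff] at hh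
        rcases hh with rfl | rfl | rfl | rfl | rfl | rfl <;>
          exact absurd (hR01.att v hv _ hvw) (by decide)
      · exact hRQ v hv w hh hvw)
  have hnot : ∀ u, u ∉ ({h 0, h 1} ∪ Pst G h : Set V) →
      u ∉ ({h 2, h 3, h 4, h 5, h 6, h 7} ∪ Qst G h : Set V) → ∀ z, u ≠ h z := by
    intro u h1 h2 z hz
    have : ∀ z : Fin 8, (z = 0 ∨ z = 1) ∨ (z = 2 ∨ z = 3 ∨ z = 4 ∨ z = 5 ∨ z = 6 ∨ z = 7) := by
      decide
    rcases this z with hh | hh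
    · apply h1
      left
      rcases hh with rfl | rfl <;> simp [hz]
    · apply h2
      left
      rcases hh with rfl | rfl | rfl | rfl | rfl | rfl <;> simp [hz]
  rcases halt with hN | ⟨u, huX, huW, ⟨v, hv, hvu⟩, w, hw, huw⟩
  · exact step3_cut hP hE hA ⟨r, hRA comp_self⟩ hAX hAW hN
  · have hu := hnot u huX huW
    have hA01 : Piece G h A [0, 1] := ⟨hA, fun v hv => hnot v (hAX v hv) (hAW v hv), by
      intro v hv z hz
      have : ∀ z : Fin 8, z ∈ [(0 : Fin 8), 1] ∨ (z = 2 ∨ z = 3 ∨ z = 4 ∨ z = 5 ∨ z = 6 ∨ z = 7) := by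
        decide
      rcases this z with hh | hh
      · exact hh
      · exfalso
        apply hANW v hv (h z) ?_ hz
        left
        rcases hh with rfl | rfl | rfl | rfl | rfl | rfl <;> simp⟩
    have hA0 : Att G h A 0 := hRatt0.mono hRA
    have hAP : ∀ v ∈ A, v ∉ Pst G h := fun v hv hh => hAX v hv (Or.inr hh)
    have huP : u ∉ Pst G h := fun hh => huX (Or.inr hh)
    have hiP : ∀ v ∈ insert u A, v ∉ Pst G h := by
      rintro v (rfl | hv)
      · exact huP
      · exact hAP v hv
    have hi0 : Att G h (insert u A) 0 := hA0.mono (Set.subset_insert _ _)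
    have hci : c ∈ insert u A := Set.mem_insert_of_mem _ (hRA hc)
    -- the case where `u` attaches to the template outside `h 0, h 1`
    have caseI : ∀ z : Fin 8, z ∉ [(0 : Fin 8), 1] → G.Adj u (h z) → False := by
      intro z hz01 huz
      have hpz : Piece G h (insert u A) [0, 1, z] := hA01.insert hv hvu hu
        (by simp) (fun z' hz' => by simp [att_one hP hE hu hz' huz])
      have hiz : Att G h (insert u A) z := ⟨u, by simp, huz⟩
      obtain ⟨hpo, hp1, q, hqo, hq3, hpq⟩ := hpP
      have hpp : Piece G h (insert p (insert u A)) [0, 1, z] := hpz.insert hci hcp hpo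
        (fun _ hh => hh) (fun z' hz' => by simp [att_one hP hE hpo hz' hp1])
      have hpp1 : Att G h (insert p (insert u A)) 1 := ⟨p, by simp, hp1⟩
      have hppz : Att G h (insert p (insert u A)) z := hiz.mono (Set.subset_insert _ _)
      have hall : ∀ z : Fin 8, z ∈ [(0 : Fin 8), 1] ∨ z = 2 ∨ z = 3 ∨ z = 4 ∨ z = 5 ∨ z = 6 ∨ z = 7 := by
        decide
      rcases hall z with hh | rfl | rfl | rfl | rfl | rfl | rfl
      · exact hz01 hh
      · exact piece_K hP hE hpz hi0 hiz (by decide) (by decide +kernel) (by decide +kernel)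
      · exact obs1 hP hE hpz hi0 hiP hiz
      · exact piece_K hP hE hpp hpp1 hppz (by decide) (by decide +kernel) (by decide +kernel)
      · exact piece_K hP hE hpp hpp1 hppz (by decide) (by decide +kernel) (by decide +kernel)
      · exact piece_K hP hE hpz hi0 hiz (by decide) (by decide +kernel) (by decide +kernel)
      · have hpq' : Piece G h (insert q (insert p (insert u A))) [0, 1, 3, 7] :=
          hpp.insert (v := p) (by simp) hpq hqo (by simp)
            (fun z' hz' => by simp [att_one hP hE hqo hz' hq3])
        exact piece_K hP hE hpq' (x := 3) (y := 7) ⟨q, by simp, hq3⟩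
          (hppz.mono (Set.subset_insert _ _)) (by decide) (by decide +kernel) (by decide +kernel)
    have hu01 : Piece G h (insert u A) [0, 1] := hA01.insert hv hvu hu (fun _ hh => hh) (by
      intro z hz
      by_contra hh
      exact caseI z hh hz)
    rcases hw with hw | hw
    · simp only [Set.mem_insert_iff, Set.mem_singleton_iff] at hw
      rcases hw with rfl | rfl | rfl | rfl | rfl | rfl <;> exact caseI _ (by decide) huw
    · exact obs2 hP hE hu01 hi0 hiP u (by simp) w hw huw

theorem step2b (hP : Pent G) {h : Fin 8 → V} (hE : Emb G MH h) {F : Set V}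
    (hF : Piece G h F [0, 1, 2, 3]) (h0 : Att G h F 0) (h3 : Att G h F 3) : False := by
  by_cases h2 : Att G h F 2
  · exact piece_K hP hE hF h0 h2 (by decide) (by decide +kernel) (by decide +kernel)
  · refine step3 hP hE ⟨hF.conn, hF.out, ?_⟩ h0 h3
    intro u hu z hz
    have := hF.att u hu z hz
    simp only [List.mem_cons, List.not_mem_nil, or_false] at this ⊢
    rcases this with hh | hh | hh | hh
    · exact Or.inl hh
    · exact Or.inr (Or.inl hh)
    · subst hh; exact absurd ⟨u, hu, hz⟩ h2
    · exact Or.inr (Or.inr hh)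

theorem MH_refl : ∀ i j : Fin 8, MH (4 - i) (4 - j) = MH i j := by decide +kernel

theorem step2_cut (hP : Pent G) {h : Fin 8 → V} (hE : Emb G MH h) {A : Set V} (hA : Conn G A)
    (hne : A.Nonempty) (hout : ∀ v ∈ A, ∀ z, v ≠ h z)
    (hN : ∀ v ∈ A, ∀ y, y ∉ A → G.Adj v y → y = h 1 ∨ y = h 2 ∨ y = h 3) : False := by
  classical
  have ht : ∀ i j, MH i j = true → G.Adj (h i) (h j) := fun i j hh => (hE.adj i j).2 hh
  have good : ∀ z, z ∉ [(1 : Fin 8), 2, 3] → h z ∉ A ∧ h z ≠ h 2 ∧ ∀ a ∈ A, ¬ G.Adj a (h z) := by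
    intro z hz
    simp only [List.mem_cons, List.not_mem_nil, or_false, not_or] at hz
    have hzA : h z ∉ A := fun hh => hout _ hh z rfl
    refine ⟨hzA, fun hh => hz.2.1 (hE.inj _ _ hh), fun a ha haz => ?_⟩
    rcases hN a ha _ hzA haz with hh | hh | hh
    · exact hz.1 (hE.inj _ _ hh)
    · exact hz.2.1 (hE.inj _ _ hh)
    · exact hz.2.2 (hE.inj _ _ hh)
  obtain ⟨q, hq, q0, q3, hqT⟩ := hasPath_spec hE (T := fun z => decide (z ∈ [(1 : Fin 8), 2, 3]))
    (x := 1) (y := 3) (n := 3) (by decide +kernel)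
  have hinter : ∀ k, 0 < k → k < 3 → h (q k) ∉ A ∧ h (q k) ≠ h 2 ∧ ∀ a ∈ A, ¬ G.Adj a (h (q k)) :=
    fun k hk hk3 => good _ (of_decide_eq_false (hqT k hk hk3))
  have h13 : h 1 ≠ h 3 := fun hh => absurd (hE.inj _ _ hh) (by decide)
  refine star_cut hP (A := A) (c := h 2) (fun v => decide (v = h 1)) hA hne
    (fun hh => hout _ hh 2 rfl) ?_ ⟨h 5, good 5 (by decide)⟩ ?_
  · intro a ha y hy hay
    rcases hN a ha y hy hay with rfl | rfl | rfl
    · exact Or.inr (ht 2 1 (by decide +kernel))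
    · exact Or.inl rfl
    · exact Or.inr (ht 2 3 (by decide +kernel))
  · rintro y y' hy hy' hyy hcy hcy' ⟨a, ha, hay⟩ ⟨a', ha', hay'⟩
    have h3 : ¬ Even 3 := by decide
    rcases hN a ha y hy hay with rfl | rfl | rfl
    · rcases hN a' ha' y' hy' hay' with rfl | rfl | rfl
      · exact absurd rfl hyy
      · exact absurd rfl hcy'.ne
      · exact ⟨3, _, hq, by simp only [q0], by simp only [q3], hinter, by simp [h3, h13.symm]⟩
    · exact absurd rfl hcy.ne
    · rcases hN a' ha' y' hy' hay' with rfl | rfl | rfl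
      · exact ⟨3, _, hq.rev, by simp [q3], by simp [q0],
          fun k hk hk3 => hinter (3 - k) (by omega) (by omega), by simp [h3, h13.symm]⟩
      · exact absurd rfl hcy'.ne
      · exact absurd rfl hyy

theorem step2 (hP : Pent G) {h : Fin 8 → V} (hE : Emb G MH h) {F : Set V}
    (hF : Piece G h F [1, 2, 3]) (h1 : Att G h F 1) (h3 : Att G h F 3) : False := by
  obtain ⟨a, ha, ha1⟩ := id h1
  have hall : ∀ z : Fin 8, z ∈ [(1 : Fin 8), 2, 3] ∨ z ∈ [(0 : Fin 8), 4, 5, 6, 7] := by decide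
  obtain ⟨A, hFA, hA, hAX, hAW, hANW, halt⟩ := ext_lemma (G := G) (F := F)
    (X := {v | ∃ z ∈ [(1 : Fin 8), 2, 3], v = h z})
    (W := {v | ∃ z ∈ [(0 : Fin 8), 4, 5, 6, 7], v = h z}) (a := a) ha hF.conn
    (by rintro v hv ⟨z, _, hz⟩; exact hF.out v hv z hz)
    (by rintro v hv ⟨z, _, hz⟩; exact hF.out v hv z hz)
    (by
      rintro v hv w ⟨z, hz, rfl⟩ hvw
      have h1 := hF.att v hv z hvw
      clear hvw
      revert z
      decide)
  have hnot : ∀ u, u ∉ {v | ∃ z ∈ [(1 : Fin 8), 2, 3], v = h z} →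
      u ∉ {v | ∃ z ∈ [(0 : Fin 8), 4, 5, 6, 7], v = h z} → ∀ z, u ≠ h z := by
    intro u h1 h2 z hz
    rcases hall z with hh | hh
    · exact h1 ⟨z, hh, hz⟩
    · exact h2 ⟨z, hh, hz⟩
  have hAo : ∀ v ∈ A, ∀ z, v ≠ h z := fun v hv => hnot v (hAX v hv) (hAW v hv)
  rcases halt with hN | ⟨u, huX, huW, ⟨v, hv, hvu⟩, w, ⟨z, hz, rfl⟩, huz⟩
  · refine step2_cut hP hE hA ⟨a, hFA ha⟩ hAo ?_
    intro v hv y hy hvy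
    obtain ⟨z, hz, rfl⟩ := hN v hv y hy hvy
    simp only [List.mem_cons, List.not_mem_nil, or_false] at hz
    rcases hz with rfl | rfl | rfl <;> simp
  · have hu := hnot u huX huW
    have hA123 : Piece G h A [1, 2, 3] := ⟨hA, hAo, by
      intro v hv z hvz
      rcases hall z with hh | hh
      · exact hh
      · exact absurd hvz (hANW v hv _ ⟨z, hh, rfl⟩)⟩
    have hp : Piece G h (insert u A) [z, 1, 2, 3] := hA123.insert hv hvu hu
      (by simp) (fun z' hz' => by simp [att_one hP hE hu hz' huz])
    have k1 : Att G h (insert u A) 1 := (h1.mono hFA).mono (Set.subset_insert _ _)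
    have k3 : Att G h (insert u A) 3 := (h3.mono hFA).mono (Set.subset_insert _ _)
    have kz : Att G h (insert u A) z := ⟨u, by simp, huz⟩
    simp only [List.mem_cons, List.not_mem_nil, or_false] at hz
    rcases hz with rfl | rfl | rfl | rfl | rfl
    · exact step2b hP hE hp kz k3
    · have hE' : Emb G MH (fun i => h (4 - i)) :=
        emb_rot hE MH_refl (by decide)
      refine step2b hP hE' (F := insert u A) ⟨hp.conn, fun v hv z => hp.out v hv _, ?_⟩ kz k1
      intro v hv z hvz
      have := hp.att v hv _ hvz
      clear hvz
      revert z
      decide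
    · exact piece_K hP hE hp k1 kz (by decide) (by decide +kernel) (by decide +kernel)
    · exact piece_K hP hE hp kz k1 (by decide) (by decide +kernel) (by decide +kernel)
    · exact piece_K hP hE hp k3 kz (by decide) (by decide +kernel) (by decide +kernel)

theorem MH_bad : ∀ x y : Fin 8, x ≠ y → MH x y = false →
    chk MH (fun z => z == x || z == y || (MH z x && MH z y)) x y = false →
    ∃ r : Fin 8, (∀ i j : Fin 8, MH (i + r) (j + r) = MH i j) ∧
      ((x = 1 + r ∧ y = 3 + r) ∨ (x = 3 + r ∧ y = 1 + r)) ∧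
      ∀ z : Fin 8, (z + r = x ∨ z + r = y ∨ (MH (z + r) x = true ∧ MH (z + r) y = true)) →
        z ∈ [(1 : Fin 8), 2, 3] := by decide +kernel

theorem MH_col : colchk MH (fun i => pcol i.val) = true := by decide +kernel

theorem interior_conn {n : ℕ} {p : ℕ → V} (hp : IP G n p) :
    Conn G {v | ∃ i, 0 < i ∧ i < n ∧ v = p i} := by
  have key : ∀ i, i + 1 < n → Rch G {v | ∃ i, 0 < i ∧ i < n ∧ v = p i} (p 1) (p (i+1)) := by
    intro i
    induction i with
    | zero => intro _; exact Relation.ReflTransGen.refl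
    | succ i ih =>
      intro hi
      exact (ih (by omega)).trans (Rch.single ((hp (i+1) (i+1+1) (by omega) (by omega)).2.2 rfl)
        ⟨i+1, by omega, by omega, rfl⟩ ⟨i+1+1, by omega, by omega, rfl⟩)
  rintro a ⟨i, hi, hin, rfl⟩ b ⟨j, hj, hjn, rfl⟩
  have h1 := key (i-1) (by omega)
  have h2 := key (j-1) (by omega)
  rw [show i - 1 + 1 = i by omega] at h1
  rw [show j - 1 + 1 = j by omega] at h2
  exact h1.symm.trans h2

theorem no_MH (hP : Pent G) {h : Fin 8 → V} (hE : Emb G MH h) : False := by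
  obtain ⟨n, x, y, p, hg, hatt⟩ := templ hP hE (colchk_spec MH_col) (x₀ := 0) (y₀ := 2) (by decide)
    (by decide +kernel)
  have hx1 : G.Adj (p 1) (h x) := by
    rw [← hg.p0]
    exact ((hg.ip 0 1 (by omega) (by have := hg.two; omega)).2.2 rfl).symm
  have hyn : G.Adj (p (n-1)) (h y) := by
    rw [← hg.pn]
    have := hg.two
    exact (hg.ip (n-1) n (by omega) le_rfl).2.2 (by omega)
  have h3 : 3 ≤ n := by
    by_contra hlt
    have h2 : n = 2 := by have := hg.two; omega
    subst h2
    exact hg.ne (att_one hP hE (hg.out 1 (by omega) (by omega)) hx1 hyn)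
  have hatt' := hatt h3
  by_cases hc : chk MH (fun z => z == x || z == y || (MH z x && MH z y)) x y = true
  · refine path_K hP hE hc hg.ip hg.p0 hg.pn h3 hg.out ?_
    intro i hi hin z hz
    rcases hatt' i hi hin z hz with hh | hh | hh <;> simp [hh]
  · rw [Bool.not_eq_true] at hc
    obtain ⟨r, hr, hxy, hz⟩ := MH_bad x y hg.ne hg.nadj hc
    have hE' : Emb G MH (fun i => h (i + r)) := emb_rot hE hr (fun i j hij => by simpa using hij)
    have hp : Piece G (fun i => h (i + r)) {v | ∃ i, 0 < i ∧ i < n ∧ v = p i} [1, 2, 3] := by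
      refine ⟨interior_conn hg.ip, ?_, ?_⟩
      · rintro v ⟨i, hi, hin, rfl⟩ z
        exact hg.out i hi hin _
      · rintro v ⟨i, hi, hin, rfl⟩ z hvz
        exact hz z (hatt' i hi hin _ hvz)
    have ax : ∃ u ∈ {v | ∃ i, 0 < i ∧ i < n ∧ v = p i}, G.Adj u (h x) :=
      ⟨p 1, ⟨1, by omega, by omega, rfl⟩, hx1⟩
    have ay : ∃ u ∈ {v | ∃ i, 0 < i ∧ i < n ∧ v = p i}, G.Adj u (h y) :=
      ⟨p (n-1), ⟨n-1, by omega, by omega, rfl⟩, hyn⟩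
    rcases hxy with ⟨rfl, rfl⟩ | ⟨rfl, rfl⟩
    · exact step2 hP hE' hp ax ay
    · exact step2 hP hE' hp ay ax

end Main

theorem MH_theta : ∀ i j : Fin 8, thetaPlus.Adj i j ↔ MH i j = true := by
  intro i j
  unfold thetaPlus
  rw [SimpleGraph.fromRel_adj]
  revert i j
  decide +kernel

/-- every graph in `𝒢₀` is `θ⁺`-free. -/
theorem stmt_11 {V : Type*} [Fintype V] (G : SimpleGraph V) (hG : G.MemG0) :
    ¬ Nonempty (thetaPlus ↪g G) := by
  rintro ⟨e⟩
  refine no_MH (pent_of_mem hG) (h := e) ⟨fun i j hij => e.injective hij, fun i j => ?_⟩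
  rw [e.map_adj_iff, MH_theta]
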